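/- arXiv:2308.09982 — 3 statements merged into one kernel-verified Lean document; each statement's English description precedes it below -/
import Mathlib

section
/- Let $A$ be a finite subset of a group $Z$ and $\mathcal{G} \subseteq A \times A$ with $|\mathcal{G}| > (1-\varepsilon)|A|^2$ for some $0 < \varepsilon < 1/4$. Then there exists a subset $A' \subseteq A$ with $|A'| > (1-\sqrt{\varepsilon})|A|$ and $|A' \cdot A'| < \frac{|A \overset{\mathcal{G}}{\cdot} A|^4}{(1-\sqrt{\varepsilon})(1-2\sqrt{\varepsilon})^2 |A|^3}$, where $A \overset{\mathcal{G}}{\cdot} A := \{ab : (a,b) \in \mathcal{G}\}$. -/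
open Pointwise

/-- Sorted enumeration of a finite set. -/
lemma aux_sort {Z : Type*} (A : Finset Z) (u : Z → ℝ) :
    ∃ p : Fin A.card → Z, Function.Injective p ∧ (∀ k, p k ∈ A) ∧
      (∀ a ∈ A, ∃ k, p k = a) ∧ Monotone (fun k => u (p k)) := by
  let e := A.equivFin.symm
  let f : Fin A.card → ℝ := fun k => u (e k)
  let σ := Tuple.sort f
  refine ⟨fun k => (e (σ k) : Z), ?_, ?_, ?_, ?_⟩
  · intro x y h
    exact σ.injective (e.injective (Subtype.ext h))
  · intro k
    exact (e (σ k)).2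
  · intro a ha
    refine ⟨σ.symm (e.symm ⟨a, ha⟩), ?_⟩
    simp
  · exact Tuple.monotone_sort f

/-- Weighted inclusion-exclusion. -/
lemma aux_weight {Z : Type*} [DecidableEq Z] (A S T : Finset Z) (hS : S ⊆ A) (hT : T ⊆ A)
    (c : Z → Z → ℝ) (hc : ∀ a b, c a b = 0 ∨ c a b = 1) (θ : ℝ) (h0 : 0 ≤ θ) (h1 : θ ≤ 1) :
    θ * ∑ a ∈ S, ∑ b ∈ A, c a b + θ * ∑ b ∈ T, ∑ a ∈ A, c a b - θ ^ 2 * (S.card * T.card)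
      ≤ ∑ a ∈ A, ∑ b ∈ A, c a b := by
  have e1 : ∑ a ∈ S, ∑ b ∈ A, c a b
      = ∑ a ∈ A, ∑ b ∈ A, (if a ∈ S then (1:ℝ) else 0) * c a b := by
    simp_rw [← Finset.mul_sum, ite_mul, one_mul, zero_mul]
    rw [← Finset.sum_filter, Finset.filter_mem_eq_inter, Finset.inter_eq_right.2 hS]
  have e2 : ∑ b ∈ T, ∑ a ∈ A, c a b
      = ∑ a ∈ A, ∑ b ∈ A, (if b ∈ T then (1:ℝ) else 0) * c a b := by
    rw [Finset.sum_comm (s := A) (t := A)]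
    simp_rw [← Finset.mul_sum, ite_mul, one_mul, zero_mul]
    rw [← Finset.sum_filter, Finset.filter_mem_eq_inter, Finset.inter_eq_right.2 hT]
  have e3 : (S.card * T.card : ℝ)
      = ∑ a ∈ A, ∑ b ∈ A, (if a ∈ S then (1:ℝ) else 0) * (if b ∈ T then (1:ℝ) else 0) := by
    rw [← Finset.sum_mul_sum, ← Finset.sum_filter, ← Finset.sum_filter,
      Finset.filter_mem_eq_inter, Finset.inter_eq_right.2 hS,
      Finset.filter_mem_eq_inter, Finset.inter_eq_right.2 hT]
    simp
  rw [e1, e2, e3]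
  simp only [Finset.mul_sum, ← Finset.sum_add_distrib, ← Finset.sum_sub_distrib]
  refine Finset.sum_le_sum fun a _ => Finset.sum_le_sum fun b _ => ?_
  rcases hc a b with h | h <;> rw [h] <;> split_ifs <;> nlinarith [sq_nonneg (1 - θ), sq_nonneg θ]

lemma aux_pair (n S r l : ℝ) (hS0 : 0 < S) (hS : S ≤ n / 2) (hr0 : 0 ≤ r) (hl0 : 0 ≤ l)
    (hr : r ≤ n) (hl : l ≤ n)
    (h : (n - r) * (n - l) ≤ (n - S) ^ 2) :
    2 * S ≤ r + l + (if S ≤ l then l - S else 0) + (if S ≤ r then r - S else 0) := by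
  split_ifs with h1 h2 h2
  · linarith
  · push Not at h2
    by_contra! hh
    nlinarith [mul_pos (sub_pos.2 h2) hS0, mul_nonneg (sub_pos.2 h2).le (by linarith : 0 ≤ n - 2 * S + r)]
  · push Not at h1
    by_contra! hh
    nlinarith [mul_pos (sub_pos.2 h1) hS0, mul_nonneg (sub_pos.2 h1).le (by linarith : 0 ≤ n - 2 * S + l)]
  · push Not at h1 h2
    nlinarith

lemma aux_match {Z : Type*} [DecidableEq Z] (A : Finset Z)
    (c : Z → Z → ℝ) (hc : ∀ a b, c a b = 0 ∨ c a b = 1)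
    (M : ℕ) (p q : Fin M → Z) (hp : Function.Injective p) (hq : Function.Injective q)
    (hpA : ∀ k, p k ∈ A) (hqA : ∀ k, q k ∈ A) (S : ℝ) (hS0 : 0 < S) (hS : S ≤ (A.card : ℝ) / 2)
    (hSM : S ≤ M)
    (hbad : ∀ k, ((A.card : ℝ) - ∑ b ∈ A, c (p k) b) * ((A.card : ℝ) - ∑ a ∈ A, c a (q k))
      ≤ ((A.card : ℝ) - S) ^ 2) :
    S ^ 2 ≤ ∑ a ∈ A, ∑ b ∈ A, c a b := by
  have hM : (0:ℝ) < M := lt_of_lt_of_le hS0 hSM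
  set θ : ℝ := S / M with hθ
  have hθM : θ * M = S := by rw [hθ]; field_simp
  have hθ0 : 0 ≤ θ := by positivity
  have hθ1 : θ ≤ 1 := by rw [hθ, div_le_one hM]; exact hSM
  have c0 : ∀ a b, 0 ≤ c a b := fun a b => by rcases hc a b with h | h <;> rw [h] <;> norm_num
  have c1 : ∀ a b, c a b ≤ 1 := fun a b => by rcases hc a b with h | h <;> rw [h] <;> norm_num
  set r : Fin M → ℝ := fun k => ∑ b ∈ A, c (p k) b with hr
  set l : Fin M → ℝ := fun k => ∑ a ∈ A, c a (q k) with hl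
  have hpair : ∀ k, 2 * S ≤ r k + l k + (if S ≤ l k then l k - S else 0)
      + (if S ≤ r k then r k - S else 0) := by
    intro k
    refine aux_pair A.card S _ _ hS0 hS (Finset.sum_nonneg fun b _ => c0 _ _)
      (Finset.sum_nonneg fun b _ => c0 _ _) ?_ ?_ (hbad k)
    · refine (Finset.sum_le_sum fun b _ => c1 _ b).trans ?_
      simp
    · refine (Finset.sum_le_sum fun b _ => c1 b _).trans ?_
      simp
  have key : ∀ I J : Finset (Fin M), θ * ∑ k ∈ I, r k + θ * ∑ k ∈ J, l k
      - θ ^ 2 * (I.card * J.card) ≤ ∑ a ∈ A, ∑ b ∈ A, c a b := by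
    intro I J
    have := aux_weight A (I.image p) (J.image q)
      (by intro x hx; obtain ⟨k, _, rfl⟩ := Finset.mem_image.1 hx; exact hpA k)
      (by intro x hx; obtain ⟨k, _, rfl⟩ := Finset.mem_image.1 hx; exact hqA k) c hc θ hθ0 hθ1
    rwa [Finset.sum_image (fun _ _ _ _ h => hp h), Finset.sum_image (fun _ _ _ _ h => hq h),
      Finset.card_image_of_injective _ hp, Finset.card_image_of_injective _ hq] at this
  have k1 := key Finset.univ (Finset.univ.filter fun k => S ≤ l k)
  have k2 := key (Finset.univ.filter fun k => S ≤ r k) Finset.univ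
  have s1 : ∑ k, (if S ≤ l k then l k - S else 0)
      = ∑ k ∈ Finset.univ.filter (fun k => S ≤ l k), l k
        - (Finset.univ.filter fun k => S ≤ l k).card * S := by
    rw [← Finset.sum_filter, Finset.sum_sub_distrib]; simp
  have s2 : ∑ k, (if S ≤ r k then r k - S else 0)
      = ∑ k ∈ Finset.univ.filter (fun k => S ≤ r k), r k
        - (Finset.univ.filter fun k => S ≤ r k).card * S := by
    rw [← Finset.sum_filter, Finset.sum_sub_distrib]; simp
  have tot := Finset.sum_le_sum (s := Finset.univ) fun k _ => hpair k
  simp only [Finset.sum_add_distrib, s1, s2, Finset.sum_const, Finset.card_univ,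
    Fintype.card_fin, nsmul_eq_mul] at tot
  simp only [Finset.card_univ, Fintype.card_fin] at k1 k2
  have tot2 := mul_le_mul_of_nonneg_left tot hθ0
  have q1 : θ ^ 2 * ((M:ℝ) * ((Finset.univ.filter fun k => S ≤ l k).card : ℝ))
      = θ * (((Finset.univ.filter fun k => S ≤ l k).card : ℝ) * S) := by
    rw [← hθM]; ring
  have q2 : θ ^ 2 * (((Finset.univ.filter fun k => S ≤ r k).card : ℝ) * (M:ℝ))
      = θ * (((Finset.univ.filter fun k => S ≤ r k).card : ℝ) * S) := by
    rw [← hθM]; ring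
  have q3 : θ * ((M:ℝ) * (2 * S)) = 2 * S ^ 2 := by
    rw [← mul_assoc, hθM]; ring
  rw [q1] at k1
  rw [q2] at k2
  rw [q3] at tot2
  nlinarith

lemma aux_exists {Z : Type*} [DecidableEq Z] (A : Finset Z)
    (c : Z → Z → ℝ) (hc : ∀ a b, c a b = 0 ∨ c a b = 1)
    (S : ℝ) (hS0 : 0 < S) (hS : S ≤ (A.card : ℝ) / 2)
    (hH : ∑ a ∈ A, ∑ b ∈ A, c a b < S ^ 2) :
    ∃ A' ⊆ A, (A.card : ℝ) - S < A'.card ∧ ∀ a ∈ A', ∀ a' ∈ A',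
      ((A.card : ℝ) - S) ^ 2 <
        ((A.card : ℝ) - ∑ b ∈ A, c a b) * ((A.card : ℝ) - ∑ x ∈ A, c x a') := by
  have c1 : ∀ a b, c a b ≤ 1 := fun a b => by rcases hc a b with h | h <;> rw [h] <;> norm_num
  obtain ⟨p, hp, hpA, hps, hpm⟩ := aux_sort A (fun a => (A.card : ℝ) - ∑ b ∈ A, c a b)
  obtain ⟨q, hq, hqA, hqs, hqm⟩ := aux_sort A (fun a => (A.card : ℝ) - ∑ x ∈ A, c x a)
  set M := ⌈S⌉₊ with hM
  have hMS : S ≤ M := Nat.le_ceil S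
  have hMlt : (M:ℝ) < S + 1 := Nat.ceil_lt_add_one hS0.le
  have hMn : M ≤ A.card := Nat.ceil_le.2 (by linarith [(Nat.cast_nonneg A.card : (0:ℝ) ≤ A.card)])
  by_contra! hno
  refine absurd (aux_match A c hc M (fun k => p (Fin.castLE hMn k))
    (fun k => q (Fin.castLE hMn k.rev)) ?_ ?_ (fun _ => hpA _) (fun _ => hqA _) S hS0 hS hMS ?_)
    (not_le.2 hH)
  · exact hp.comp (Fin.castLE_injective hMn)
  · exact hq.comp ((Fin.castLE_injective hMn).comp Fin.rev_injective)
  intro k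
  by_contra! hk
  let I : Finset (Fin A.card) := Finset.univ.filter fun j => j < Fin.castLE hMn k
  let J : Finset (Fin A.card) := Finset.univ.filter fun j => j < Fin.castLE hMn k.rev
  have hI : I.card = k := by
    have : I = Finset.Iio (Fin.castLE hMn k) := by ext; simp [I]
    rw [this, Fin.card_Iio]; rfl
  have hJ : J.card = M - (k + 1) := by
    have : J = Finset.Iio (Fin.castLE hMn k.rev) := by ext; simp [J]
    rw [this, Fin.card_Iio]; simp [Fin.val_rev]
  have hsub : A \ (I.image p ∪ J.image q) ⊆ A := Finset.sdiff_subset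
  obtain ⟨a, ha, a', ha', hle⟩ := hno (A \ (I.image p ∪ J.image q)) hsub (by
    have h1 := Finset.le_card_sdiff (I.image p ∪ J.image q) A
    have h2 := Finset.card_union_le (I.image p) (J.image q)
    have h3 : (I.image p).card ≤ I.card := Finset.card_image_le
    have h4 : (J.image q).card ≤ J.card := Finset.card_image_le
    have h5 := k.2
    have h6 : A.card + 1 ≤ (A \ (I.image p ∪ J.image q)).card + M := by omega
    have h7 : (A.card : ℝ) + 1 ≤ (A \ (I.image p ∪ J.image q)).card + M := by exact_mod_cast h6
    linarith)
  rw [Finset.mem_sdiff, Finset.mem_union, not_or] at ha ha'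
  obtain ⟨i, rfl⟩ := hps a ha.1
  obtain ⟨j, rfl⟩ := hqs a' ha'.1
  have hi : Fin.castLE hMn k ≤ i := by
    by_contra! h
    exact ha.2.1 (Finset.mem_image_of_mem _ (by simpa [I] using h))
  have hj : Fin.castLE hMn k.rev ≤ j := by
    by_contra! h
    exact ha'.2.2 (Finset.mem_image_of_mem _ (by simpa [J] using h))
  have m1 := hpm hi
  have m2 := hqm hj
  simp only at m1 m2
  have n1 : 0 ≤ (A.card : ℝ) - ∑ b ∈ A, c (p i) b := by
    have := (Finset.sum_le_sum fun b (_ : b ∈ A) => c1 (p i) b)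
    simp at this; linarith
  have n2 : 0 ≤ (A.card : ℝ) - ∑ x ∈ A, c x (q (Fin.castLE hMn k.rev)) := by
    have := (Finset.sum_le_sum fun b (_ : b ∈ A) => c1 b (q (Fin.castLE hMn k.rev)))
    simp at this; linarith
  have := mul_le_mul m1 m2 n2 n1
  linarith

theorem stmt2 {Z : Type*} [Group Z] [DecidableEq Z]
    (A : Finset Z) (hA : A.Nonempty) (𝒢 : Finset (Z × Z)) (h𝒢A : 𝒢 ⊆ A ×ˢ A)
    (ε : ℝ) (hε0 : 0 < ε) (hε1 : ε < 1 / 4)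
    (h𝒢 : ((𝒢.card : ℝ) > (1 - ε) * (A.card : ℝ) ^ 2)) :
    ∃ A' : Finset Z, A' ⊆ A ∧
      ((A'.card : ℝ) > (1 - Real.sqrt ε) * (A.card : ℝ)) ∧
      ((A' * A').card : ℝ) <
        ((𝒢.image (fun p => p.1 * p.2)).card : ℝ) ^ 4 /
          ((1 - Real.sqrt ε) * (1 - 2 * Real.sqrt ε) ^ 2 * (A.card : ℝ) ^ 3) := by
  set s := Real.sqrt ε with hs
  have hs0 : 0 < s := Real.sqrt_pos.2 hε0
  have hs2 : s ^ 2 = ε := Real.sq_sqrt hε0.le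
  have hs1 : s < 1 / 2 := by nlinarith
  have hn : (0:ℝ) < A.card := by exact_mod_cast hA.card_pos
  set n : ℝ := (A.card : ℝ) with hndef
  let c : Z → Z → ℝ := fun a b => if (a, b) ∈ 𝒢 then 0 else 1
  have hc : ∀ a b, c a b = 0 ∨ c a b = 1 := by
    intro a b; simp only [c]; split_ifs <;> simp
  set H := (A ×ˢ A) \ 𝒢 with hHdef
  have hHsum : ∑ a ∈ A, ∑ b ∈ A, c a b = H.card := by
    rw [← Finset.sum_product' A A c, Finset.card_eq_sum_ones]
    push_cast
    rw [hHdef, Finset.sdiff_eq_filter, Finset.sum_filter]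
    refine Finset.sum_congr rfl fun x _ => ?_
    simp only [c]
    split_ifs <;> simp_all
  have hHcard : (H.card : ℝ) + 𝒢.card = n ^ 2 := by
    have := Finset.card_sdiff_add_card_eq_card h𝒢A
    rw [Finset.card_product] at this
    rw [hndef, sq]; exact_mod_cast this
  have hHlt : (H.card : ℝ) < (s * n) ^ 2 := by rw [mul_pow, hs2]; linarith
  obtain ⟨A', hA'A, hA'c, hA'⟩ := aux_exists A c hc (s * n) (by positivity)
    (by rw [← hndef]; nlinarith) (by rw [hHsum]; exact hHlt)
  refine ⟨A', hA'A, by rw [← hndef] at hA'c; linarith, ?_⟩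
  set P := 𝒢.image (fun p => p.1 * p.2) with hP
  -- lower bound on |P|
  have hK : (1 - ε) * n < P.card := by
    have h1 : 𝒢.card ≤ (A ×ˢ P).card := by
      refine Finset.card_le_card_of_injOn (fun x => (x.1, x.1 * x.2)) ?_ ?_
      · intro x hx
        have hx' : x ∈ 𝒢 := hx
        have := Finset.mem_product.1 (h𝒢A hx')
        exact Finset.mem_product.2 ⟨this.1, Finset.mem_image_of_mem (fun p : Z × Z => p.1 * p.2) hx'⟩
      · rintro ⟨a, b⟩ _ ⟨a', b'⟩ _ h
        simp only [Prod.mk.injEq] at h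
        obtain ⟨rfl, h⟩ := h
        simpa using h
    rw [Finset.card_product] at h1
    have h2 : (𝒢.card : ℝ) ≤ n * P.card := by rw [hndef]; exact_mod_cast h1
    by_contra! h
    nlinarith
  -- representatives
  have hrep : ∀ x ∈ A' * A', ∃ y : Z × Z, y.1 ∈ A' ∧ y.2 ∈ A' ∧ y.1 * y.2 = x := by
    intro x hx
    obtain ⟨a, ha, b, hb, h⟩ := Finset.mem_mul.1 hx
    exact ⟨(a, b), ha, hb, h⟩
  choose! y hy1 hy2 hy3 using hrep
  let W : Z → Finset (Z × Z) := fun x =>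
    ((A.filter fun z => (z, (y x).2) ∈ 𝒢) ×ˢ (A.filter fun b => ((y x).1, b) ∈ 𝒢)).filter
      fun z => z ∈ 𝒢
  have hW : ∀ x ∈ A' * A', (1 - 2 * s) * n ^ 2 < (W x).card := by
    intro x hx
    have h1 := hA' _ (hy1 x hx) _ (hy2 x hx)
    set L := A.filter fun z => (z, (y x).2) ∈ 𝒢
    set R := A.filter fun b => ((y x).1, b) ∈ 𝒢
    have hR : (A.card : ℝ) - ∑ b ∈ A, c (y x).1 b = R.card := by
      rw [Finset.card_eq_sum_ones, Finset.card_eq_sum_ones]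
      push_cast
      rw [Finset.sum_filter, ← Finset.sum_sub_distrib]
      refine Finset.sum_congr rfl fun b _ => ?_
      simp only [c]; split_ifs <;> simp
    have hL : (A.card : ℝ) - ∑ z ∈ A, c z (y x).2 = L.card := by
      rw [Finset.card_eq_sum_ones, Finset.card_eq_sum_ones]
      push_cast
      rw [Finset.sum_filter, ← Finset.sum_sub_distrib]
      refine Finset.sum_congr rfl fun b _ => ?_
      simp only [c]; split_ifs <;> simp
    rw [hR, hL] at h1
    have h2 : (L ×ˢ R).card ≤ (W x).card + H.card := by
      rw [← Finset.card_filter_add_card_filter_not (s := L ×ˢ R) (fun z => z ∈ 𝒢)]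
      refine Nat.add_le_add_left (Finset.card_le_card ?_) _
      intro z hz
      rw [Finset.mem_filter, Finset.mem_product] at hz
      rw [hHdef, Finset.mem_sdiff, Finset.mem_product]
      exact ⟨⟨(Finset.mem_filter.1 hz.1.1).1, (Finset.mem_filter.1 hz.1.2).1⟩, hz.2⟩
    rw [Finset.card_product] at h2
    have h3 : (L.card : ℝ) * R.card ≤ (W x).card + H.card := by exact_mod_cast h2
    rw [← hndef] at h1
    nlinarith
  -- injection
  have hinj : ((A' * A').sigma W).card ≤ (P ×ˢ P ×ˢ P).card := by
    refine Finset.card_le_card_of_injOn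
      (fun t => ((y t.1).1 * t.2.2, t.2.1 * t.2.2, t.2.1 * (y t.1).2)) ?_ ?_
    · rintro ⟨x, z, b⟩ ht
      have ht' := Finset.mem_sigma.1 ht
      simp only [W, Finset.mem_filter, Finset.mem_product] at ht'
      obtain ⟨_, ⟨⟨_, h1⟩, _, h2⟩, h3⟩ := ht'
      refine Finset.mem_product.2 ⟨?_, Finset.mem_product.2 ⟨?_, ?_⟩⟩
      · exact Finset.mem_image_of_mem (fun p : Z × Z => p.1 * p.2) h2
      · exact Finset.mem_image_of_mem (fun p : Z × Z => p.1 * p.2) h3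
      · exact Finset.mem_image_of_mem (fun p : Z × Z => p.1 * p.2) h1
    · rintro ⟨x, z, b⟩ ht ⟨x', z', b'⟩ ht' h
      have hx := (Finset.mem_sigma.1 ht).1
      have hx' := (Finset.mem_sigma.1 ht').1
      simp only [Prod.mk.injEq] at h hx hx'
      obtain ⟨h1, h2, h3⟩ := h
      have e : ∀ u v : Z, ∀ z b : Z, u * v = (u * b) * (z * b)⁻¹ * (z * v) := by
        intro u v z b; group
      have hxx : x = x' := by
        rw [← hy3 x hx, ← hy3 x' hx', e (y x).1 (y x).2 z b, e (y x').1 (y x').2 z' b', h1, h2, h3]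
      subst hxx
      have hb := mul_left_cancel h1
      have hz := mul_right_cancel h3
      subst hb hz
      rfl
  rw [Finset.card_sigma, Finset.card_product, Finset.card_product] at hinj
  have hinj' : ∑ x ∈ A' * A', ((W x).card : ℝ) ≤ (P.card : ℝ) ^ 3 := by
    rw [show (P.card : ℝ) ^ 3 = P.card * (P.card * P.card) by ring]
    exact_mod_cast hinj
  have hA'ne : A'.Nonempty := by
    rw [← Finset.card_pos]
    have : (0:ℝ) < A'.card := by rw [← hndef] at hA'c; nlinarith
    exact_mod_cast this
  have hlt := Finset.sum_lt_sum_of_nonempty (hA'ne.mul hA'ne) hW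
  rw [Finset.sum_const, nsmul_eq_mul] at hlt
  have hmain := hlt.trans_le hinj'
  have d1 : 0 < 1 - s := by linarith
  have d2 : 0 < 1 - 2 * s := by linarith
  rw [lt_div_iff₀ (by positivity)]
  have hK2 : (1 - s) * (1 - 2 * s) * n ≤ P.card := by
    refine le_trans ?_ hK.le
    refine mul_le_mul_of_nonneg_right ?_ hn.le
    nlinarith
  have hP0 : (0:ℝ) < (1 - s) * (1 - 2 * s) * n := by positivity
  calc ((A' * A').card : ℝ) * ((1 - s) * (1 - 2 * s) ^ 2 * n ^ 3)
      = ((A' * A').card * ((1 - 2 * s) * n ^ 2)) * ((1 - s) * (1 - 2 * s) * n) := by ring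
    _ < (P.card : ℝ) ^ 3 * ((1 - s) * (1 - 2 * s) * n) := mul_lt_mul_of_pos_right hmain hP0
    _ ≤ (P.card : ℝ) ^ 3 * P.card := mul_le_mul_of_nonneg_left hK2 (by positivity)
    _ = (P.card : ℝ) ^ 4 := by ring
end

section
/- Let $q_1, q_2$ be positive integers and $0 < \delta < 1/8$. Let $A, B \subseteq \mathbb{Z}/q_1\mathbb{Z} \times \mathbb{Z}/q_2\mathbb{Z}$ with $|A|, |B| > (q_1 q_2)^{1-\delta}$. Then there exist divisors $q_1' \mid q_1$, $q_2' \mid q_2$ with $q_1' q_2' < (q_1 q_2)^{10\delta}$ such that $\sum_{96} (AB - AB) \supseteq q_1'\mathbb{Z}/q_1\mathbb{Z} \times q_2'\mathbb{Z}/q_2\mathbb{Z}$, where $AB = \{ab : a \in A, b \in B\}$ (componentwise product) and $\sum_{96}$ denotes the 96-fold sumset. -/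
open Pointwise

/-- `foldSum n s` is the `n`-fold sumset `s + s + ⋯ + s`. -/
def foldSum {α : Type*} [AddCommMonoid α] [DecidableEq α] : ℕ → Finset α → Finset α
  | 0, _ => {0}
  | n + 1, s => s + foldSum n s

set_option linter.unusedSectionVars false
lemma addChar_sum {R ι : Type*} [CommRing R] (ψ : AddChar R ℂ) (s : Finset ι) (f : ι → R) :
    ψ (∑ i ∈ s, f i) = ∏ i ∈ s, ψ (f i) := by
  classical
  induction s using Finset.induction_on with
  | empty => simp
  | insert a s ha ih => rw [Finset.sum_insert ha, Finset.prod_insert ha, AddChar.map_add_eq_mul, ih]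

open Finset
section gen
variable {R : Type*} [CommRing R] [Fintype R] [DecidableEq R]

def annCard (d : R) : ℕ := (univ.filter (fun x : R => d * x = 0)).card

lemma annCard_pos (d : R) : 0 < annCard d :=
  card_pos.2 ⟨0, by simp⟩

lemma fiber_card (d x0 : R) : (univ.filter (fun x : R => d * x = d * x0)).card = annCard d := by
  refine card_bij (fun x _ => x - x0) ?_ ?_ ?_
  · intro x hx
    simp only [mem_filter, mem_univ, true_and] at hx ⊢
    rw [mul_sub, hx, sub_self]
  · intro x _ y _ h
    simpa using h
  · intro y hy
    simp only [mem_filter, mem_univ, true_and] at hy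
    exact ⟨y + x0, by simp [mul_add, hy], by simp⟩

lemma annCard_mul_le (d m : R) : annCard (d * m) ≤ annCard d * annCard m := by
  have h : Set.MapsTo (fun x => m * x) ((univ.filter (fun x : R => d * m * x = 0) : Finset R) : Set R)
      ((univ.filter (fun x : R => d * x = 0) : Finset R) : Set R) := by
    intro x hx
    simp only [coe_filter, mem_univ, true_and, Set.mem_ofPred_eq] at hx ⊢
    rw [← mul_assoc, hx]
  unfold annCard
  rw [card_eq_sum_card_fiberwise h, ← smul_eq_mul]
  refine sum_le_card_nsmul _ _ _ ?_
  intro y _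
  by_cases hy : ∃ x0, m * x0 = y
  · obtain ⟨x0, rfl⟩ := hy
    have := fiber_card m x0
    unfold annCard at this
    rw [← this]
    apply card_le_card
    intro x hx
    simp only [mem_filter, mem_univ, true_and] at hx ⊢
    exact hx.2
  · rw [card_eq_zero.2]
    · simp
    · ext x
      simp only [mem_filter, mem_univ, true_and, notMem_empty, iff_false]
      rintro ⟨_, h⟩
      exact hy ⟨x, h⟩

lemma annCard_ann (η m : R) (h : ∀ x, η * x = 0 ↔ m ∣ x) :
    annCard m * annCard η = Fintype.card R := by
  have hm : Set.MapsTo (fun x => m * x) ((univ : Finset R) : Set R)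
      ((univ.filter (fun x : R => η * x = 0) : Finset R) : Set R) := by
    intro x _
    simp only [coe_filter, mem_univ, true_and, Set.mem_ofPred_eq]
    exact (h _).2 (dvd_mul_right _ _)
  rw [← card_univ, card_eq_sum_card_fiberwise hm]
  rw [sum_const_nat (m := annCard m)]
  · rw [mul_comm]; rfl
  · intro y hy
    simp only [mem_filter, mem_univ, true_and] at hy
    obtain ⟨x0, rfl⟩ := (h y).1 hy
    exact fiber_card m x0

/-- number of `v` with `a + d v ∈ A` -/
def densN (A : Finset R) (d a : R) : ℕ := (univ.filter (fun v : R => a + d * v ∈ A)).card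

lemma dens_fiber (A : Finset R) (η m u : R) (h : ∀ x, η * x = 0 ↔ m ∣ x) :
    densN A m u = annCard m * (A.filter (fun x => η * x = η * u)).card := by
  have hm : Set.MapsTo (fun v => u + m * v) ((univ.filter (fun v : R => u + m * v ∈ A) : Finset R) : Set R)
      ((A.filter (fun x : R => η * x = η * u) : Finset R) : Set R) := by
    intro x hx
    simp only [coe_filter, mem_univ, true_and, Set.mem_ofPred_eq] at hx ⊢
    refine ⟨hx, ?_⟩
    rw [mul_add, (h (m * x)).2 (dvd_mul_right _ _), add_zero]
  unfold densN
  rw [card_eq_sum_card_fiberwise hm, sum_const_nat (m := annCard m), mul_comm]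
  intro y hy
  simp only [mem_filter] at hy
  obtain ⟨x0, hx0⟩ := (h (y - u)).1 (by rw [mul_sub, hy.2, sub_self])
  rw [← fiber_card m x0]
  congr 1
  ext x
  simp only [mem_filter, mem_univ, true_and]
  rw [← hx0]
  constructor
  · rintro ⟨_, h2⟩
    rw [← h2]; ring
  · intro h2
    have : u + m * x = y := by rw [h2]; ring
    exact ⟨this ▸ hy.1, this⟩

/-- the pseudorandomness condition -/
def PR (A : Finset R) : Prop := ∀ m u : R, (densN A m u : ℝ) ^ 4 ≤ (A.card : ℝ) ^ 4 * annCard m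

lemma fiber_bound (A : Finset R) (hA : PR A) (η m : R) (h : ∀ x, η * x = 0 ↔ m ∣ x)
    (k : ℝ) (hk : 0 < k) (hk4 : k ^ 4 = annCard m) (u : R) :
    ((A.filter (fun x => η * x = η * u)).card : ℝ) ≤ A.card / k ^ 3 := by
  have h1 := hA m u
  rw [dens_fiber A η m u h] at h1
  push_cast at h1
  rw [← hk4] at h1
  rw [le_div_iff₀ (by positivity)]
  refine le_of_pow_le_pow_left₀ (n := 4) (by norm_num) (by positivity) ?_
  have hk4' : 0 < k ^ 4 := by positivity
  refine le_of_mul_le_mul_right ?_ hk4'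
  calc _ = (k ^ 4 * ((A.filter (fun x => η * x = η * u)).card : ℝ)) ^ 4 := by ring
    _ ≤ _ := h1

noncomputable def GG (ψ : AddChar R ℂ) (B : Finset R) (t : R) : ℝ := ‖∑ v ∈ B, ψ (t * v)‖ ^ 2

lemma GG_nonneg (ψ : AddChar R ℂ) (B : Finset R) (t : R) : 0 ≤ GG ψ B t := by
  unfold GG; positivity

lemma GG_eq (ψ : AddChar R ℂ) (B : Finset R) (t : R) :
    (GG ψ B t : ℂ) = ∑ v ∈ B, ∑ v' ∈ B, ψ (t * (v - v')) := by
  unfold GG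
  push_cast
  rw [← Complex.mul_conj', map_sum, sum_mul_sum]
  refine sum_congr rfl fun v _ => sum_congr rfl fun v' _ => ?_
  rw [← AddChar.map_neg_eq_conj, ← AddChar.map_add_eq_mul]
  congr 1; ring

lemma GG_sum (ψ : AddChar R ℂ) (hψ : ψ.IsPrimitive) (B : Finset R) (η : R) :
    ∑ s, GG ψ B (η * s) =
      Fintype.card R * ∑ v ∈ B, ((B.filter (fun x => η * x = η * v)).card : ℝ) := by
  have : ((∑ s, GG ψ B (η * s) : ℝ) : ℂ) =
      ((Fintype.card R * ∑ v ∈ B, ((B.filter (fun x => η * x = η * v)).card : ℝ) : ℝ) : ℂ) := by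
    push_cast
    simp_rw [GG_eq]
    rw [sum_comm, mul_sum]
    refine sum_congr rfl fun v _ => ?_
    rw [sum_comm]
    have : ∀ v' ∈ B, ∑ s, ψ (η * s * (v - v')) =
        if η * v' = η * v then (Fintype.card R : ℂ) else 0 := by
      intro v' _
      have := AddChar.sum_mulShift (η * (v - v')) hψ
      rw [show (∑ s, ψ (η * s * (v - v'))) = ∑ s, ψ (s * (η * (v - v'))) from
        sum_congr rfl fun s _ => by congr 1; ring, this]
      have e : η * (v - v') = 0 ↔ η * v' = η * v := by
        rw [mul_sub, sub_eq_zero, eq_comm]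
      simp only [e]
      split_ifs <;> simp
    rw [sum_congr rfl this, ← sum_filter, sum_const, nsmul_eq_mul, mul_comm]
  exact_mod_cast this

lemma sum_A_bound (A : Finset R) (η : R) (F : ℝ)
    (hF : ∀ u, ((A.filter (fun x => η * x = η * u)).card : ℝ) ≤ F)
    (G : R → ℝ) (hG : ∀ t, 0 ≤ G t) (u' : R) :
    (∑ u ∈ A, G (η * (u - u'))) * annCard η ≤ F * ∑ s, G (η * s) := by
  have e1 : ∑ s, G (η * s) = ∑ s, G (η * (s - u')) :=
    (Equiv.sum_comp (Equiv.subRight u') (fun s => G (η * s))).symm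
  rw [e1, sum_mul, mul_sum]
  calc ∑ u ∈ A, G (η * (u - u')) * annCard η
      = ∑ u ∈ A, ∑ s ∈ univ.filter (fun s => η * s = η * u), G (η * (s - u')) := by
        refine sum_congr rfl fun u _ => ?_
        rw [← fiber_card η u, mul_comm, ← nsmul_eq_mul, ← sum_const]
        refine sum_congr rfl fun s hs => ?_
        simp only [mem_filter, mem_univ, true_and] at hs
        rw [mul_sub, mul_sub, hs]
    _ = ∑ s, ∑ u ∈ A.filter (fun u => η * u = η * s), G (η * (s - u')) := by
        simp_rw [sum_filter]
        rw [sum_comm]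
        refine sum_congr rfl fun s _ => sum_congr rfl fun u _ => ?_
        simp only [eq_comm]
    _ ≤ _ := by
        refine sum_le_sum fun s _ => ?_
        rw [sum_const, nsmul_eq_mul]
        exact mul_le_mul_of_nonneg_right (hF s) (hG _)

noncomputable def TT (ψ : AddChar R ℂ) (A B : Finset R) (η : R) : ℝ :=
  ∑ u' ∈ A, ∑ u ∈ A, GG ψ B (η * (u - u'))

lemma TT_nonneg (ψ : AddChar R ℂ) (A B : Finset R) (η : R) : 0 ≤ TT ψ A B η :=
  sum_nonneg fun _ _ => sum_nonneg fun _ _ => GG_nonneg _ _ _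

lemma TT_zero (ψ : AddChar R ℂ) (A B : Finset R) :
    TT ψ A B 0 = (A.card : ℝ) ^ 2 * (B.card : ℝ) ^ 2 := by
  simp [TT, GG]; ring

lemma TT_bound (ψ : AddChar R ℂ) (hψ : ψ.IsPrimitive) (A B : Finset R) (hA : PR A) (hB : PR B)
    (η m : R) (h : ∀ x, η * x = 0 ↔ m ∣ x) :
    TT ψ A B η ^ 48 ≤ ((A.card : ℝ) ^ 2 * (B.card : ℝ) ^ 2) ^ 48 *
      ((annCard η : ℝ) / Fintype.card R) ^ 24 := by
  have hm : (0 : ℝ) < annCard m := by exact_mod_cast annCard_pos m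
  have hw : (0 : ℝ) < annCard η := by exact_mod_cast annCard_pos η
  have hQ : (annCard m : ℝ) * annCard η = Fintype.card R := by
    exact_mod_cast annCard_ann η m h
  obtain ⟨k, hk, hk4⟩ : ∃ k : ℝ, 0 < k ∧ k ^ 4 = annCard m := by
    refine ⟨(annCard m : ℝ) ^ ((4 : ℕ) : ℝ)⁻¹, by positivity, ?_⟩
    exact Real.rpow_inv_natCast_pow hm.le (by norm_num)
  have fA := fiber_bound A hA η m h k hk hk4
  have fB := fiber_bound B hB η m h k hk hk4
  have b1 : ∑ s, GG ψ B (η * s) ≤ Fintype.card R * (B.card * (B.card / k ^ 3)) := by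
    rw [GG_sum ψ hψ]
    refine mul_le_mul_of_nonneg_left ?_ (by positivity)
    rw [← nsmul_eq_mul]
    exact sum_le_card_nsmul _ _ _ fun v _ => fB v
  have b2 : TT ψ A B η * annCard η ≤
      A.card * (A.card / k ^ 3 * (Fintype.card R * (B.card * (B.card / k ^ 3)))) := by
    unfold TT
    rw [sum_mul, ← nsmul_eq_mul]
    refine sum_le_card_nsmul _ _ _ fun u' _ => ?_
    refine (sum_A_bound A η _ fA _ (GG_nonneg ψ B) u').trans ?_
    exact mul_le_mul_of_nonneg_left b1 (by positivity)
  have b3 : TT ψ A B η ≤ (A.card : ℝ) ^ 2 * (B.card : ℝ) ^ 2 / k ^ 2 := by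
    refine le_of_mul_le_mul_right (b2.trans (le_of_eq ?_)) hw
    rw [← hQ, ← hk4]
    field_simp
  calc TT ψ A B η ^ 48 ≤ ((A.card : ℝ) ^ 2 * (B.card : ℝ) ^ 2 / k ^ 2) ^ 48 :=
        pow_le_pow_left₀ (TT_nonneg _ _ _ _) b3 _
    _ = _ := by
        rw [← hQ, ← hk4]
        field_simp

lemma main_gen (ψ : AddChar R ℂ) (hψ : ψ.IsPrimitive)
    (hann : ∀ η : R, ∃ m, ∀ x, η * x = 0 ↔ m ∣ x)
    (hsum : ∑ η ∈ univ.erase (0 : R), ((annCard η : ℝ) / Fintype.card R) ^ 24 < 1)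
    (A B : Finset R) (hA : PR A) (hB : PR B) (hA0 : A.Nonempty) (hB0 : B.Nonempty) (z : R) :
    ∃ s : Fin 48 → (R × R) × (R × R),
      (∀ i, s i ∈ (A ×ˢ A) ×ˢ (B ×ˢ B)) ∧
      ∑ i, ((s i).1.2 - (s i).1.1) * ((s i).2.1 - (s i).2.2) = z := by
  by_contra! hcon
  have hT : ∀ η, (TT ψ A B η : ℂ) = ∑ p ∈ (A ×ˢ A) ×ˢ (B ×ˢ B),
      ψ (η * ((p.1.2 - p.1.1) * (p.2.1 - p.2.2))) := by
    intro η
    unfold TT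
    push_cast
    simp_rw [GG_eq, sum_product, mul_assoc]
  have hzero : ∑ η, (TT ψ A B η : ℂ) ^ 48 * ψ (-(η * z)) = 0 := by
    simp_rw [hT, sum_pow', sum_mul]
    rw [sum_comm]
    refine sum_eq_zero fun s hs => ?_
    rw [Fintype.mem_piFinset] at hs
    have hne := hcon s hs
    have := AddChar.sum_mulShift
      ((∑ i, ((s i).1.2 - (s i).1.1) * ((s i).2.1 - (s i).2.2)) - z) hψ
    rw [if_neg (sub_ne_zero.2 hne)] at this
    rw [Nat.cast_zero] at this
    rw [← this]
    refine sum_congr rfl fun η _ => ?_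
    rw [← addChar_sum, ← AddChar.map_add_eq_mul, ← mul_sum]
    congr 1; ring
  rw [← add_sum_erase _ _ (mem_univ (0 : R))] at hzero
  set N : ℝ := (A.card : ℝ) ^ 2 * (B.card : ℝ) ^ 2 with hN
  have hNpos : 0 < N := by
    have := hA0.card_pos
    have := hB0.card_pos
    positivity
  have hlt : ‖∑ η ∈ univ.erase (0 : R), (TT ψ A B η : ℂ) ^ 48 * ψ (-(η * z))‖ < N ^ 48 := by
    calc _ ≤ ∑ η ∈ univ.erase (0 : R), ‖(TT ψ A B η : ℂ) ^ 48 * ψ (-(η * z))‖ := norm_sum_le _ _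
      _ ≤ ∑ η ∈ univ.erase (0 : R), N ^ 48 * ((annCard η : ℝ) / Fintype.card R) ^ 24 := by
          refine sum_le_sum fun η _ => ?_
          rw [norm_mul, AddChar.norm_apply, mul_one, norm_pow, Complex.norm_real,
            Real.norm_of_nonneg (TT_nonneg _ _ _ _)]
          obtain ⟨m, hm⟩ := hann η
          exact TT_bound ψ hψ A B hA hB η m hm
      _ = N ^ 48 * ∑ η ∈ univ.erase (0 : R), ((annCard η : ℝ) / Fintype.card R) ^ 24 := by
          rw [mul_sum]
      _ < N ^ 48 * 1 := by gcongr
      _ = _ := mul_one _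
  have h0 : ‖(TT ψ A B 0 : ℂ) ^ 48 * ψ (-(0 * z))‖ = N ^ 48 := by
    rw [norm_mul, AddChar.norm_apply, mul_one, norm_pow, Complex.norm_real,
      Real.norm_of_nonneg (TT_nonneg _ _ _ _), TT_zero]
  rw [eq_neg_of_add_eq_zero_left hzero, norm_neg] at h0
  exact absurd h0 hlt.ne

/-- pass to a pseudorandom piece -/
lemma exists_PR (A : Finset R) (hA : A.Nonempty) :
    ∃ d a : R, PR (univ.filter (fun u : R => a + d * u ∈ A)) ∧
      (univ.filter (fun u : R => a + d * u ∈ A)).Nonempty ∧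
      (annCard d : ℝ) * (A.card : ℝ) ^ 4 ≤ (Fintype.card R : ℝ) ^ 4 := by
  obtain ⟨⟨d, a⟩, -, hmax⟩ := exists_max_image (univ : Finset (R × R))
    (fun p => (densN A p.1 p.2 : ℝ) ^ 4 / annCard p.1) ⟨(0, 0), mem_univ _⟩
  have hw : ∀ d : R, (0 : ℝ) < annCard d := fun d => by exact_mod_cast annCard_pos d
  have h1 : (A.card : ℝ) ^ 4 * annCard d ≤ (densN A d a : ℝ) ^ 4 := by
    have := hmax (1, 0) (mem_univ _)
    have e1 : densN A 1 0 = A.card := by simp [densN]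
    have e2 : annCard (1 : R) = 1 := by simp [annCard, filter_eq']
    simp only [e1, e2, Nat.cast_one, div_one] at this
    rwa [le_div_iff₀ (hw d)] at this
  have hc := hA.card_pos
  refine ⟨d, a, ?_, ?_, ?_⟩
  · intro m u
    have h2 := hmax (d * m, a + d * u) (mem_univ _)
    have e : densN (univ.filter (fun u : R => a + d * u ∈ A)) m u = densN A (d * m) (a + d * u) := by
      unfold densN
      congr 1
      ext x
      simp only [mem_filter, mem_univ, true_and]
      rw [show a + d * (u + m * x) = a + d * u + d * m * x by ring]
    rw [e]
    change _ ≤ (densN A d a : ℝ) ^ 4 * _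
    simp only at h2
    rw [div_le_div_iff₀ (hw _) (hw _)] at h2
    refine le_of_mul_le_mul_right (h2.trans ?_) (hw d)
    rw [mul_assoc]
    refine mul_le_mul_of_nonneg_left ?_ (by positivity)
    rw [mul_comm (annCard m : ℝ)]
    exact_mod_cast annCard_mul_le d m
  · rw [← card_pos]
    change 0 < densN A d a
    by_contra h
    have h0 : densN A d a = 0 := by omega
    rw [h0] at h1
    have := hw d
    have : 0 < (A.card : ℝ) ^ 4 * annCard d := by positivity
    norm_num at h1
    linarith
  · rw [mul_comm]
    refine h1.trans (pow_le_pow_left₀ (by positivity) ?_ 4)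
    exact_mod_cast card_le_univ _

lemma foldSum_mem (X : Finset R) : ∀ (n : ℕ) (f : Fin n → R),
    (∀ i, ∃ x ∈ X, ∃ y ∈ X, f i = x + y) → ∑ i, f i ∈ foldSum (2 * n) X
  | 0, f, _ => by simp [foldSum]
  | n + 1, f, h => by
    rw [Fin.sum_univ_succ]
    obtain ⟨x, hx, y, hy, e⟩ := h 0
    rw [e, add_assoc]
    change _ ∈ X + (X + foldSum (2 * n) X)
    exact add_mem_add hx (add_mem_add hy (foldSum_mem X n _ fun i => h i.succ))

lemma main_ring (ψ : AddChar R ℂ) (hψ : ψ.IsPrimitive)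
    (hann : ∀ η : R, ∃ m, ∀ x, η * x = 0 ↔ m ∣ x)
    (hsum : ∑ η ∈ univ.erase (0 : R), ((annCard η : ℝ) / Fintype.card R) ^ 24 < 1)
    (A B : Finset R) (hA0 : A.Nonempty) (hB0 : B.Nonempty) :
    ∃ g : R, (annCard g : ℝ) * ((A.card : ℝ) ^ 4 * (B.card : ℝ) ^ 4) ≤ (Fintype.card R : ℝ) ^ 8 ∧
      ∀ z, g * z ∈ foldSum 96 (A * B - A * B) := by
  obtain ⟨d, a, pA, nA, cA⟩ := exists_PR A hA0
  obtain ⟨e, b, pB, nB, cB⟩ := exists_PR B hB0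
  refine ⟨d * e, ?_, fun z => ?_⟩
  · calc (annCard (d * e) : ℝ) * ((A.card : ℝ) ^ 4 * (B.card : ℝ) ^ 4)
        ≤ (annCard d * annCard e) * ((A.card : ℝ) ^ 4 * (B.card : ℝ) ^ 4) := by
          refine mul_le_mul_of_nonneg_right ?_ (by positivity)
          exact_mod_cast annCard_mul_le d e
      _ = (annCard d * (A.card : ℝ) ^ 4) * (annCard e * (B.card : ℝ) ^ 4) := by ring
      _ ≤ (Fintype.card R : ℝ) ^ 4 * (Fintype.card R : ℝ) ^ 4 := by gcongr
      _ = _ := by ring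
  · obtain ⟨s, hs, rfl⟩ := main_gen ψ hψ hann hsum _ _ pA pB nA nB z
    rw [mul_sum]
    refine foldSum_mem _ 48 _ fun i => ?_
    have := hs i
    generalize s i = p at this ⊢
    obtain ⟨⟨u', u⟩, v, v'⟩ := p
    simp only [mem_product, mem_filter, mem_univ, true_and] at this ⊢
    obtain ⟨⟨h1, h2⟩, h3, h4⟩ := this
    refine ⟨_, sub_mem_sub (mul_mem_mul h2 h3) (mul_mem_mul h1 h3),
      _, sub_mem_sub (mul_mem_mul h1 h4) (mul_mem_mul h2 h4), ?_⟩
    ring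
end gen

section zm
variable {q : ℕ} [NeZero q]

lemma zmod_annCard_mul (η : ZMod q) : annCard η * addOrderOf η = q := by
  have hm : Set.MapsTo (fun x => η * x) ((univ : Finset (ZMod q)) : Set (ZMod q))
      ((univ.image (fun x => η * x) : Finset (ZMod q)) : Set (ZMod q)) := by
    intro x _
    simp
  have h1 := card_eq_sum_card_fiberwise hm
  rw [sum_const_nat (m := annCard η), card_univ, ZMod.card] at h1
  · have h2 : (univ.image (fun x => η * x) : Finset (ZMod q)).card = addOrderOf η := by
      rw [← Nat.card_zmultiples, ← Set.ncard_coe_finset]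
      change _ = ((AddSubgroup.zmultiples η : AddSubgroup (ZMod q)) : Set (ZMod q)).ncard
      congr 1
      ext y
      simp only [coe_image, coe_univ, Set.image_univ, Set.mem_range, SetLike.mem_coe,
        AddSubgroup.mem_zmultiples_iff]
      constructor
      · rintro ⟨x, rfl⟩
        refine ⟨(x.val : ℤ), ?_⟩
        rw [zsmul_eq_mul, Int.cast_natCast, ZMod.natCast_zmod_val, mul_comm]
      · rintro ⟨k, rfl⟩
        exact ⟨(k : ZMod q), by rw [zsmul_eq_mul, mul_comm]⟩
    rw [h2, mul_comm] at h1
    exact h1.symm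
  · intro y hy
    simp only [mem_image, mem_univ, true_and] at hy
    obtain ⟨x0, rfl⟩ := hy
    exact fiber_card η x0

lemma zmod_annCard (η : ZMod q) : annCard η = q.gcd η.val := by
  have h1 := zmod_annCard_mul η
  have h2 := ZMod.addOrderOf_coe η.val (NeZero.ne q)
  rw [ZMod.natCast_zmod_val] at h2
  have h3 : q.gcd η.val * addOrderOf η = q := by
    rw [h2]; exact Nat.mul_div_cancel' (Nat.gcd_dvd_left _ _)
  have h4 : 0 < addOrderOf η := addOrderOf_pos η
  exact Nat.eq_of_mul_eq_mul_right h4 (h1.trans h3.symm)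

lemma zmod_ann (η : ZMod q) : ∃ m : ZMod q, ∀ x, η * x = 0 ↔ m ∣ x := by
  set g := q.gcd η.val with hg
  have gpos : 0 < g := Nat.gcd_pos_of_pos_left _ (NeZero.pos q)
  obtain ⟨r, hr⟩ : g ∣ q := Nat.gcd_dvd_left _ _
  obtain ⟨t, ht⟩ : g ∣ η.val := Nat.gcd_dvd_right _ _
  have hcop : Nat.Coprime r t := by
    have := Nat.coprime_div_gcd_div_gcd (m := q) (n := η.val) gpos
    rw [← hg] at this
    rwa [Nat.div_eq_of_eq_mul_right gpos hr, Nat.div_eq_of_eq_mul_right gpos ht] at this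
  have he : η = ((g * t : ℕ) : ZMod q) := by rw [← ht, ZMod.natCast_zmod_val]
  refine ⟨(r : ZMod q), fun x => ⟨fun h => ?_, ?_⟩⟩
  · have hx : x = (x.val : ZMod q) := (ZMod.natCast_zmod_val x).symm
    rw [he, hx, ← Nat.cast_mul, ZMod.natCast_eq_zero_iff] at h
    have h' : g * r ∣ g * (t * x.val) := by rw [← hr, ← mul_assoc]; exact h
    have h'' := hcop.dvd_of_dvd_mul_left (Nat.dvd_of_mul_dvd_mul_left gpos h')
    obtain ⟨s, hs⟩ := h''
    rw [hx, hs]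
    push_cast
    exact dvd_mul_right _ _
  · rintro ⟨s, rfl⟩
    rw [← mul_assoc, he, ← Nat.cast_mul, show g * t * r = q * t by rw [hr]; ring]
    simp

lemma zmod_gcd_mul (g : ZMod q) : ∃ t : ZMod q, ((q.gcd g.val : ℕ) : ZMod q) = g * t := by
  have := Nat.gcd_eq_gcd_ab q g.val
  have h2 : (((q.gcd g.val : ℕ) : ℤ) : ZMod q) =
      ((q * q.gcdA g.val + g.val * q.gcdB g.val : ℤ) : ZMod q) := by rw [this]
  push_cast at h2
  rw [ZMod.natCast_zmod_val, ZMod.natCast_self, zero_mul, zero_add] at h2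
  exact ⟨_, h2⟩

lemma aux_sum (N : ℕ) : ∑ n ∈ Icc (1 : ℕ) (N + 1), ((n : ℝ) * (1 / (n : ℝ)) ^ 24) ≤
    (5 : ℝ) / 4 - 1 / (4 * ((N : ℝ) + 1)) := by
  induction N with
  | zero => norm_num
  | succ N ih =>
    rw [sum_Icc_succ_top (by omega)]
    have h : ((N + 1 + 1 : ℕ) : ℝ) * (1 / (N + 1 + 1 : ℕ)) ^ 24 ≤
        1 / (4 * (N + 1)) - 1 / (4 * ((N + 1 : ℕ) + 1)) := by
      push_cast
      set x : ℝ := (N : ℝ) + 1 with hx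
      have hx1 : 1 ≤ x := by rw [hx]; linarith [(Nat.cast_nonneg N : (0 : ℝ) ≤ N)]
      have e : 1 / (4 * x) - 1 / (4 * (x + 1)) = 1 / (4 * x * (x + 1)) := by field_simp; ring
      have e2 : (x + 1) * (1 / (x + 1)) ^ 24 = 1 / (x + 1) ^ 23 := by field_simp
      rw [e, e2]
      apply one_div_le_one_div_of_le (by positivity)
      calc 4 * x * (x + 1) ≤ (x + 1) ^ 4 := by nlinarith [sq_nonneg (x - 1), pow_pos (by linarith : 0 < x) 3, pow_pos (by linarith : 0 < x) 4, pow_pos (by linarith : 0 < x) 2]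
        _ ≤ (x + 1) ^ 23 := pow_le_pow_right₀ (by linarith) (by norm_num)
    push_cast at ih h ⊢
    linarith

lemma zmod_sum : ∑ η : ZMod q, ((annCard η : ℝ) / q) ^ 24 ≤ 5 / 4 := by
  have hq : 0 < q := NeZero.pos q
  have e : ∀ η : ZMod q, (annCard η : ℝ) / q = 1 / addOrderOf η := by
    intro η
    have h := zmod_annCard_mul η
    have h4 : (0 : ℝ) < addOrderOf η := by exact_mod_cast addOrderOf_pos η
    have h5 : (0 : ℝ) < q := by exact_mod_cast hq
    rw [div_eq_div_iff h5.ne' h4.ne', one_mul]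
    exact_mod_cast h
  simp_rw [e]
  have hm : ∀ η ∈ (univ : Finset (ZMod q)), addOrderOf η ∈ q.divisors := by
    intro η _
    rw [Nat.mem_divisors]
    exact ⟨⟨annCard η, by rw [mul_comm, zmod_annCard_mul]⟩, hq.ne'⟩
  rw [← sum_fiberwise_of_maps_to hm]
  calc _ ≤ ∑ n ∈ q.divisors, ((n : ℝ) * (1 / n) ^ 24) := by
        refine sum_le_sum fun n hn => ?_
        have : ∀ η ∈ univ.filter (fun η : ZMod q => addOrderOf η = n),
            ((1 : ℝ) / addOrderOf η) ^ 24 = (1 / n) ^ 24 := by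
          intro η hη
          simp only [mem_filter, mem_univ, true_and] at hη
          rw [hη]
        rw [sum_congr rfl this, sum_const, nsmul_eq_mul]
        refine mul_le_mul_of_nonneg_right ?_ (by positivity)
        rw [IsAddCyclic.card_addOrderOf_eq_totient
          (by rw [ZMod.card]; exact Nat.dvd_of_mem_divisors hn)]
        exact_mod_cast Nat.totient_le n
    _ ≤ ∑ n ∈ Icc (1 : ℕ) (q - 1 + 1), ((n : ℝ) * (1 / n) ^ 24) := by
        refine sum_le_sum_of_subset_of_nonneg ?_ fun _ _ _ => by positivity
        intro n hn
        have h1 := Nat.divisor_le hn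
        have h2 := Nat.pos_of_mem_divisors hn
        rw [mem_Icc]; omega
    _ ≤ _ := aux_sum _
    _ ≤ 5 / 4 := by
        have : (0 : ℝ) ≤ 1 / (4 * ((q - 1 : ℕ) + 1)) := by positivity
        linarith
end zm

section prod
variable {q₁ q₂ : ℕ} [NeZero q₁] [NeZero q₂]

lemma annCard_prod (η : ZMod q₁ × ZMod q₂) : annCard η = annCard η.1 * annCard η.2 := by
  unfold annCard
  rw [← card_product]
  congr 1
  ext x
  simp [Prod.ext_iff]

lemma prod_ann (η : ZMod q₁ × ZMod q₂) : ∃ m : ZMod q₁ × ZMod q₂, ∀ x, η * x = 0 ↔ m ∣ x := by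
  obtain ⟨m1, h1⟩ := zmod_ann η.1
  obtain ⟨m2, h2⟩ := zmod_ann η.2
  refine ⟨(m1, m2), fun x => ?_⟩
  rw [Prod.ext_iff]
  simp only [Prod.fst_mul, Prod.snd_mul, Prod.fst_zero, Prod.snd_zero, h1, h2]
  constructor
  · rintro ⟨⟨a, ha⟩, b, hb⟩
    exact ⟨(a, b), Prod.ext ha hb⟩
  · rintro ⟨c, rfl⟩
    exact ⟨⟨c.1, rfl⟩, c.2, rfl⟩

lemma prod_sum : ∑ η ∈ univ.erase (0 : ZMod q₁ × ZMod q₂),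
    ((annCard η : ℝ) / Fintype.card (ZMod q₁ × ZMod q₂)) ^ 24 < 1 := by
  have hq1 : (q₁ : ℝ) ≠ 0 := by exact_mod_cast NeZero.ne q₁
  have hq2 : (q₂ : ℝ) ≠ 0 := by exact_mod_cast NeZero.ne q₂
  have h1 : ∑ η : ZMod q₁ × ZMod q₂,
      ((annCard η : ℝ) / Fintype.card (ZMod q₁ × ZMod q₂)) ^ 24 =
      (∑ η : ZMod q₁, ((annCard η : ℝ) / q₁) ^ 24) * ∑ η : ZMod q₂, ((annCard η : ℝ) / q₂) ^ 24 := by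
    rw [sum_mul_sum, Fintype.sum_prod_type]
    refine sum_congr rfl fun a _ => sum_congr rfl fun b _ => ?_
    rw [annCard_prod, Fintype.card_prod, ZMod.card, ZMod.card]
    push_cast
    rw [← mul_pow, div_mul_div_comm]
  rw [← add_sum_erase _ _ (mem_univ (0 : ZMod q₁ × ZMod q₂))] at h1
  have h0 : ((annCard (0 : ZMod q₁ × ZMod q₂) : ℝ) / Fintype.card (ZMod q₁ × ZMod q₂)) ^ 24 = 1 := by
    have : annCard (0 : ZMod q₁ × ZMod q₂) = Fintype.card (ZMod q₁ × ZMod q₂) := by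
      simp [annCard]
    rw [this, div_self, one_pow]
    exact_mod_cast Fintype.card_ne_zero
  rw [h0] at h1
  have h2 : (∑ η : ZMod q₁, ((annCard η : ℝ) / q₁) ^ 24) * ∑ η : ZMod q₂, ((annCard η : ℝ) / q₂) ^ 24
      ≤ (5 / 4) * (5 / 4) :=
    mul_le_mul zmod_sum zmod_sum (sum_nonneg fun _ _ => by positivity) (by norm_num)
  linarith

noncomputable def prodChar (q₁ q₂ : ℕ) [NeZero q₁] [NeZero q₂] : AddChar (ZMod q₁ × ZMod q₂) ℂ where
  toFun p := ZMod.stdAddChar p.1 * ZMod.stdAddChar p.2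
  map_zero_eq_one' := by simp
  map_add_eq_mul' a b := by
    simp only [Prod.fst_add, Prod.snd_add, AddChar.map_add_eq_mul]; ring

lemma prodChar_apply (p : ZMod q₁ × ZMod q₂) :
    prodChar q₁ q₂ p = ZMod.stdAddChar p.1 * ZMod.stdAddChar p.2 := rfl

lemma prodChar_primitive : (prodChar q₁ q₂).IsPrimitive := by
  intro a ha h
  apply ha
  have key : ∀ x, prodChar q₁ q₂ (a * x) = 1 := fun x => by
    have := DFunLike.congr_fun h x
    simpa [AddChar.mulShift_apply] using this
  refine Prod.ext ?_ ?_
  · by_contra hne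
    refine ZMod.isPrimitive_stdAddChar q₁ hne ?_
    ext x
    have := key (x, 0)
    simpa [prodChar_apply, AddChar.mulShift_apply] using this
  · by_contra hne
    refine ZMod.isPrimitive_stdAddChar q₂ hne ?_
    ext x
    have := key (0, x)
    simpa [prodChar_apply, AddChar.mulShift_apply] using this
end prod

theorem stmt9 (q₁ q₂ : ℕ) (hq₁ : 0 < q₁) (hq₂ : 0 < q₂)
    (δ : ℝ) (hδ0 : 0 < δ) (hδ1 : δ < 1 / 8)
    (A B : Finset (ZMod q₁ × ZMod q₂))
    (hA : ((A.card : ℝ) > ((q₁ * q₂ : ℕ) : ℝ) ^ ((1 : ℝ) - δ)))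
    (hB : ((B.card : ℝ) > ((q₁ * q₂ : ℕ) : ℝ) ^ ((1 : ℝ) - δ))) :
    ∃ q₁' q₂' : ℕ, q₁' ∣ q₁ ∧ q₂' ∣ q₂ ∧
      (((q₁' * q₂' : ℕ) : ℝ) < ((q₁ * q₂ : ℕ) : ℝ) ^ (10 * δ)) ∧
      ∀ x : ZMod q₁, ∀ y : ZMod q₂,
        ((q₁' : ZMod q₁) * x, (q₂' : ZMod q₂) * y) ∈ foldSum 96 (A * B - A * B) := by
  have : NeZero q₁ := ⟨hq₁.ne'⟩
  have : NeZero q₂ := ⟨hq₂.ne'⟩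
  have hQ1 : (1 : ℝ) ≤ ((q₁ * q₂ : ℕ) : ℝ) := by exact_mod_cast Nat.mul_pos hq₁ hq₂
  have hQ : Fintype.card (ZMod q₁ × ZMod q₂) = q₁ * q₂ := by
    rw [Fintype.card_prod, ZMod.card, ZMod.card]
  generalize hQdef : ((q₁ * q₂ : ℕ) : ℝ) = Q at *
  have hQ0 : 0 < Q := by linarith
  have hP : 0 < Q ^ (1 - δ) := by positivity
  have hA0 : A.Nonempty := by
    rw [← Finset.card_pos]; exact_mod_cast hP.trans hA
  have hB0 : B.Nonempty := by
    rw [← Finset.card_pos]; exact_mod_cast hP.trans hB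
  obtain ⟨g, hg, hmem⟩ := main_ring (prodChar q₁ q₂) prodChar_primitive prod_ann prod_sum A B hA0 hB0
  rw [hQ, hQdef] at hg
  obtain ⟨t1, ht1⟩ := zmod_gcd_mul g.1
  obtain ⟨t2, ht2⟩ := zmod_gcd_mul g.2
  refine ⟨q₁.gcd g.1.val, q₂.gcd g.2.val, Nat.gcd_dvd_left _ _, Nat.gcd_dvd_left _ _, ?_, ?_⟩
  · rw [← zmod_annCard, ← zmod_annCard, ← annCard_prod]
    have hpow : (Q ^ (1 - δ)) ^ 4 * (Q ^ (1 - δ)) ^ 4 * Q ^ (8 * δ) = Q ^ 8 := by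
      rw [← pow_add, ← Real.rpow_natCast, ← Real.rpow_mul hQ0.le, ← Real.rpow_add hQ0,
        ← Real.rpow_natCast]
      congr 1
      push_cast; ring
    have hw : (0 : ℝ) < annCard g := by exact_mod_cast annCard_pos g
    have h1 : (Q ^ (1 - δ)) ^ 4 * (Q ^ (1 - δ)) ^ 4 < (A.card : ℝ) ^ 4 * (B.card : ℝ) ^ 4 := by
      gcongr
    have h2 : (annCard g : ℝ) < Q ^ (8 * δ) := by
      have h3 : (annCard g : ℝ) * ((Q ^ (1 - δ)) ^ 4 * (Q ^ (1 - δ)) ^ 4) <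
          Q ^ (8 * δ) * ((Q ^ (1 - δ)) ^ 4 * (Q ^ (1 - δ)) ^ 4) := by
        calc _ < (annCard g : ℝ) * ((A.card : ℝ) ^ 4 * (B.card : ℝ) ^ 4) := by gcongr
          _ ≤ Q ^ 8 := hg
          _ = _ := by rw [← hpow]; ring
      exact lt_of_mul_lt_mul_right h3 (by positivity)
    exact h2.trans_le (Real.rpow_le_rpow_of_exponent_le hQ1 (by linarith))
  · intro x y
    have := hmem (t1 * x, t2 * y)
    rw [ht1, ht2, mul_assoc, mul_assoc]
    exact this
end

section
/- Let $0 < \gamma < 1/4$ and let $A, B \subseteq \mathbb{Z}/q\mathbb{Z}$ with $|A|, |B| > q^{1-\gamma}$. Then there exists a divisor $q' \mid q$ with $q' < q^{12\gamma/5}$ such that $q'\mathbb{Z}/q\mathbb{Z} \subseteq \sum_{24} (AB - AB)$, where $AB = \{ab : a \in A, b \in B\}$ and $\sum_{24}$ denotes the 24-fold sumset. -/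
open Pointwise

theorem bilin {q : ℕ} [NeZero q] (k x y : ZMod q) (d e m : ℕ)
    (hm : addOrderOf (k * d * e) = m) (A B : Finset (ZMod q))
    (hA : ∀ a ∈ A, (d : ZMod q) ∣ a - x) (hB : ∀ b ∈ B, (e : ZMod q) ∣ b - y)
    (MA MB : ℝ)
    (hMA : ∀ z, ((A.filter (fun a => ((d * m : ℕ) : ZMod q) ∣ a - z)).card : ℝ) ≤ MA)
    (hMB : ∀ z, ((B.filter (fun b => ((e * m : ℕ) : ZMod q) ∣ b - z)).card : ℝ) ≤ MB)
    (u : ZMod q → ℂ) :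
    ∑ a ∈ A, ‖∑ b ∈ B, u b * ZMod.stdAddChar (N := q) (k * a * b)‖ ^ 2
      ≤ (m * MA * MB : ℝ) * ∑ b ∈ B, ‖u b‖ ^ 2 := by
  have hm0 : 0 < m := by rw [← hm]; exact addOrderOf_pos _
  have hmc : (m : ZMod q) * (k * d * e) = 0 := by
    rw [← nsmul_eq_mul, ← hm]; exact addOrderOf_nsmul_eq_zero _
  have hMA0 : 0 ≤ MA := le_trans (by positivity) (hMA 0)
  set f : ZMod q → ℝ := fun a => ‖∑ b ∈ B, u b * ZMod.stdAddChar (N := q) (k * a * b)‖ ^ 2 with hf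
  have hf0 : ∀ a, 0 ≤ f a := fun a => by positivity
  -- periodicity
  have hper : ∀ z s : ZMod q, f (z + d * m * s) = f z := by
    intro z s
    simp only [hf]
    congr 1
    have : ∑ b ∈ B, u b * ZMod.stdAddChar (N := q) (k * (z + d * m * s) * b)
        = (∑ b ∈ B, u b * ZMod.stdAddChar (N := q) (k * z * b)) * ZMod.stdAddChar (N := q) (k * d * m * s * y) := by
      rw [Finset.sum_mul]
      refine Finset.sum_congr rfl fun b hb => ?_
      obtain ⟨β, hβ⟩ := hB b hb
      rw [mul_assoc (u b), ← AddChar.map_add_eq_mul]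
      congr 2
      have : b = y + e * β := by rw [← hβ]; ring
      rw [this]
      linear_combination (s * β) * hmc
    rw [this, norm_mul, AddChar.norm_apply, mul_one]
  have h1 : ∑ a ∈ A, f a ≤ MA * ∑ t ∈ Finset.range m, f (x + d * (t : ℕ)) := by
    have h2 : ∀ a ∈ A, f a ≤ ∑ t ∈ Finset.range m,
        if ((d * m : ℕ) : ZMod q) ∣ a - (x + d * (t : ℕ)) then f (x + d * (t : ℕ)) else 0 := by
      intro a ha
      obtain ⟨α, hα⟩ := hA a ha
      have hαv : α = ((α.val % m : ℕ) : ZMod q) + m * ((α.val / m : ℕ) : ZMod q) := by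
        conv_lhs => rw [← ZMod.natCast_zmod_val α, ← Nat.mod_add_div α.val m]
        push_cast; ring
      have ha' : a = (x + d * ((α.val % m : ℕ) : ZMod q)) + d * m * ((α.val / m : ℕ) : ZMod q) := by
        linear_combination hα + d * hαv
      have hdv : ((d * m : ℕ) : ZMod q) ∣ a - (x + d * ((α.val % m : ℕ) : ZMod q)) := by
        refine ⟨((α.val / m : ℕ) : ZMod q), ?_⟩
        push_cast
        linear_combination ha'
      have hfa : f a = if ((d * m : ℕ) : ZMod q) ∣ a - (x + d * ((α.val % m : ℕ) : ZMod q))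
          then f (x + d * ((α.val % m : ℕ) : ZMod q)) else 0 := by
        rw [if_pos hdv, ← hper (x + d * ((α.val % m : ℕ) : ZMod q)) ((α.val / m : ℕ) : ZMod q)]
        exact congrArg f ha'
      rw [hfa]
      refine Finset.single_le_sum (f := fun t : ℕ =>
        if ((d * m : ℕ) : ZMod q) ∣ a - (x + d * (t : ℕ)) then f (x + d * (t : ℕ)) else 0) ?_
        (Finset.mem_range.2 (Nat.mod_lt _ hm0))
      intro t _
      split_ifs
      · exact hf0 _
      · exact le_rfl
    refine (Finset.sum_le_sum h2).trans ?_
    rw [Finset.sum_comm, Finset.mul_sum]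
    refine Finset.sum_le_sum fun t _ => ?_
    rw [← Finset.sum_filter, Finset.sum_const, nsmul_eq_mul]
    exact mul_le_mul_of_nonneg_right (hMA _) (hf0 _)
  -- orthogonality
  have horth : ∀ b ∈ B, ∀ b' ∈ B, ‖∑ t ∈ Finset.range m,
      (ZMod.stdAddChar (N := q) (k * d * (b - b')) : ℂ) ^ t‖
      ≤ if ((e * m : ℕ) : ZMod q) ∣ b - b' then (m : ℝ) else 0 := by
    intro b hb b' hb'
    obtain ⟨β, hβ⟩ := hB b hb
    obtain ⟨β', hβ'⟩ := hB b' hb'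
    have hbb : b - b' = e * (β - β') := by linear_combination hβ - hβ'
    by_cases hz : (ZMod.stdAddChar (N := q) (k * d * (b - b')) : ℂ) = 1
    · have h0 : k * d * (b - b') = 0 := by
        apply ZMod.injective_stdAddChar
        rw [hz, AddChar.map_zero_eq_one]
      have h3 : (β - β').val • (k * d * e) = 0 := by
        rw [nsmul_eq_mul, ZMod.natCast_zmod_val]
        rw [hbb] at h0
        linear_combination h0
      have h4 := addOrderOf_dvd_of_nsmul_eq_zero h3
      rw [hm] at h4
      obtain ⟨s, hs⟩ := h4
      have h5 : ((e * m : ℕ) : ZMod q) ∣ b - b' := by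
        refine ⟨s, ?_⟩
        rw [hbb, ← ZMod.natCast_zmod_val (β - β'), hs]
        push_cast; ring
      rw [if_pos h5, hz]
      simp
    · have hpow : (ZMod.stdAddChar (N := q) (k * d * (b - b')) : ℂ) ^ m = 1 := by
        rw [← AddChar.map_nsmul_eq_pow, nsmul_eq_mul, hbb]
        have : (m : ZMod q) * (k * d * (e * (β - β'))) = 0 := by
          linear_combination (β - β') * hmc
        rw [this, AddChar.map_zero_eq_one]
      rw [geom_sum_eq hz, hpow]
      simp only [sub_self, zero_div, norm_zero]
      split_ifs <;> positivity
  have h2 : ∑ t ∈ Finset.range m, f (x + d * (t : ℕ)) ≤ m * MB * ∑ b ∈ B, ‖u b‖ ^ 2 := by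
    have hexp : ((∑ t ∈ Finset.range m, f (x + d * (t : ℕ)) : ℝ) : ℂ)
        = ∑ b ∈ B, ∑ b' ∈ B, (u b * ZMod.stdAddChar (N := q) (k * x * b)) *
          (starRingEnd ℂ) (u b' * ZMod.stdAddChar (N := q) (k * x * b')) *
          ∑ t ∈ Finset.range m, (ZMod.stdAddChar (N := q) (k * d * (b - b')) : ℂ) ^ t := by
      simp_rw [Finset.mul_sum]
      rw [Finset.sum_congr rfl (fun b _ => Finset.sum_comm), Finset.sum_comm]
      push_cast
      refine Finset.sum_congr rfl fun t _ => ?_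
      simp only [hf]
      push_cast
      rw [← Complex.mul_conj', map_sum, Finset.sum_mul_sum]
      refine Finset.sum_congr rfl fun b _ => Finset.sum_congr rfl fun b' _ => ?_
      simp only [map_mul]
      rw [← AddChar.map_neg_eq_conj, ← AddChar.map_neg_eq_conj, ← AddChar.map_nsmul_eq_pow]
      rw [show k * (x + d * (t : ZMod q)) * b = k * x * b + k * d * t * b by ring,
        show -(k * (x + d * (t : ZMod q)) * b') = -(k * x * b') + -(k * d * t * b') by ring,
        show t • (k * d * (b - b')) = k * d * t * b + -(k * d * t * b') by
          rw [nsmul_eq_mul]; ring]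
      simp only [AddChar.map_add_eq_mul]
      ring
    have hn : ∑ t ∈ Finset.range m, f (x + d * (t : ℕ)) =
        ‖((∑ t ∈ Finset.range m, f (x + d * (t : ℕ)) : ℝ) : ℂ)‖ := by
      rw [Complex.norm_real, Real.norm_of_nonneg (Finset.sum_nonneg fun _ _ => hf0 _)]
    rw [hn, hexp]
    have h3 : ‖∑ b ∈ B, ∑ b' ∈ B, (u b * ZMod.stdAddChar (N := q) (k * x * b)) *
          (starRingEnd ℂ) (u b' * ZMod.stdAddChar (N := q) (k * x * b')) *
          ∑ t ∈ Finset.range m, (ZMod.stdAddChar (N := q) (k * d * (b - b')) : ℂ) ^ t‖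
        ≤ ∑ b ∈ B, ∑ b' ∈ B, ((if ((e * m : ℕ) : ZMod q) ∣ b - b' then (m : ℝ) * ‖u b‖ ^ 2 / 2 else 0)
          + (if ((e * m : ℕ) : ZMod q) ∣ b' - b then (m : ℝ) * ‖u b'‖ ^ 2 / 2 else 0)) := by
      refine (norm_sum_le _ _).trans (Finset.sum_le_sum fun b hb => ?_)
      refine (norm_sum_le _ _).trans (Finset.sum_le_sum fun b' hb' => ?_)
      rw [norm_mul, norm_mul, RCLike.norm_conj, norm_mul, norm_mul, AddChar.norm_apply,
        AddChar.norm_apply, mul_one, mul_one]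
      have hsw : ((e * m : ℕ) : ZMod q) ∣ b' - b ↔ ((e * m : ℕ) : ZMod q) ∣ b - b' := dvd_sub_comm
      have := mul_le_mul_of_nonneg_left (horth b hb b' hb')
        (mul_nonneg (norm_nonneg (u b)) (norm_nonneg (u b')))
      refine this.trans ?_
      simp only [hsw]
      split_ifs
      · nlinarith [mul_nonneg (Nat.cast_nonneg (α := ℝ) m) (sq_nonneg (‖u b‖ - ‖u b'‖))]
      · simp
    refine h3.trans ?_
    have h4 : ∀ b ∈ B, ∑ b' ∈ B, (if ((e * m : ℕ) : ZMod q) ∣ b' - b then (m : ℝ) * ‖u b‖ ^ 2 / 2 else 0)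
        ≤ MB * (m * ‖u b‖ ^ 2 / 2) := by
      intro b _
      rw [← Finset.sum_filter, Finset.sum_const, nsmul_eq_mul]
      exact mul_le_mul_of_nonneg_right (hMB _) (by positivity)
    simp only [Finset.sum_add_distrib]
    have h5 : ∑ b ∈ B, ∑ b' ∈ B, (if ((e * m : ℕ) : ZMod q) ∣ b - b' then (m : ℝ) * ‖u b‖ ^ 2 / 2 else 0)
        ≤ ∑ b ∈ B, MB * (m * ‖u b‖ ^ 2 / 2) := by
      refine Finset.sum_le_sum fun b hb => ?_
      refine le_trans (le_of_eq ?_) (h4 b hb)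
      refine Finset.sum_congr rfl fun b' _ => ?_
      exact if_congr dvd_sub_comm rfl rfl
    have h6 : ∑ b ∈ B, ∑ b' ∈ B, (if ((e * m : ℕ) : ZMod q) ∣ b' - b then (m : ℝ) * ‖u b'‖ ^ 2 / 2 else 0)
        ≤ ∑ b ∈ B, MB * (m * ‖u b‖ ^ 2 / 2) := by
      rw [Finset.sum_comm]
      refine Finset.sum_le_sum fun b hb => ?_
      refine le_trans (le_of_eq ?_) (h4 b hb)
      refine Finset.sum_congr rfl fun b' _ => ?_
      exact if_congr dvd_sub_comm rfl rfl
    refine (add_le_add h5 h6).trans (le_of_eq ?_)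
    rw [← Finset.sum_add_distrib, Finset.mul_sum]
    refine Finset.sum_congr rfl fun b _ => ?_
    ring
  calc ∑ a ∈ A, f a ≤ MA * ∑ t ∈ Finset.range m, f (x + d * (t : ℕ)) := h1
    _ ≤ MA * (m * MB * ∑ b ∈ B, ‖u b‖ ^ 2) := by gcongr
    _ = _ := by ring

/-- Number of ways to write `z` as `∑ aᵢ (bᵢ - bᵢ₊₁)` along a path in `B` from `b0` to `b`. -/
noncomputable def rc {q : ℕ} [NeZero q] (A B : Finset (ZMod q)) (b0 : ZMod q) :
    ℕ → ZMod q → ZMod q → ℂ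
  | 0, b, z => if b = b0 ∧ z = 0 then 1 else 0
  | n + 1, b, z => ∑ b' ∈ B, ∑ a ∈ A, rc A B b0 n b' (z - a * (b' - b))

theorem rc_mem {q : ℕ} [NeZero q] (A B A' B' : Finset (ZMod q)) (hA : A ⊆ A') (hB : B ⊆ B')
    (b0 : ZMod q) (n : ℕ) : ∀ b ∈ B, ∀ z, rc A B b0 n b z ≠ 0 →
      z ∈ foldSum n (A' * B' - A' * B') := by
  induction n with
  | zero =>
    intro b _ z h
    simp only [rc, ne_eq, ite_eq_right_iff, one_ne_zero, imp_false, not_not] at h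
    simp [foldSum, h.2]
  | succ n ih =>
    intro b hb z h
    simp only [rc] at h
    obtain ⟨b', hb', h⟩ := Finset.exists_ne_zero_of_sum_ne_zero h
    obtain ⟨a, ha, h⟩ := Finset.exists_ne_zero_of_sum_ne_zero h
    have h1 := ih b' hb' _ h
    simp only [foldSum]
    have : z = (a * b' - a * b) + (z - a * (b' - b)) := by ring
    rw [this]
    exact Finset.add_mem_add (Finset.sub_mem_sub (Finset.mul_mem_mul (hA ha) (hB hb'))
      (Finset.mul_mem_mul (hA ha) (hB hb))) h1

theorem rc_dvd {q : ℕ} [NeZero q] (A B : Finset (ZMod q)) (x y d e : ZMod q)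
    (hA : ∀ a ∈ A, d ∣ a - x) (hB : ∀ b ∈ B, e ∣ b - y)
    (b0 : ZMod q) (n : ℕ) : ∀ b ∈ B, ∀ z, rc A B b0 n b z ≠ 0 →
      d * e ∣ z - x * (b0 - b) := by
  induction n with
  | zero =>
    intro b _ z h
    simp only [rc, ne_eq, ite_eq_right_iff, one_ne_zero, imp_false, not_not] at h
    simp [h.1, h.2]
  | succ n ih =>
    intro b hb z h
    simp only [rc] at h
    obtain ⟨b', hb', h⟩ := Finset.exists_ne_zero_of_sum_ne_zero h
    obtain ⟨a, ha, h⟩ := Finset.exists_ne_zero_of_sum_ne_zero h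
    have h1 := ih b' hb' _ h
    have : z - x * (b0 - b) = (z - a * (b' - b) - x * (b0 - b')) + (a - x) * ((b' - y) - (b - y)) := by
      ring
    rw [this]
    exact dvd_add h1 (mul_dvd_mul (hA a ha) (dvd_sub (hB b' hb') (hB b hb)))

/-- Fourier coefficient of `rc`. -/
noncomputable def vc {q : ℕ} [NeZero q] (A B : Finset (ZMod q)) (b0 k : ZMod q) (n : ℕ)
    (b : ZMod q) : ℂ := ∑ z, rc A B b0 n b z * ZMod.stdAddChar (N := q) (k * z)

/-- Half step. -/
noncomputable def wc {q : ℕ} [NeZero q] (A B : Finset (ZMod q)) (b0 k : ZMod q) (n : ℕ)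
    (a : ZMod q) : ℂ := ∑ b ∈ B, vc A B b0 k n b * ZMod.stdAddChar (N := q) (k * a * b)

theorem vc_zero {q : ℕ} [NeZero q] (A B : Finset (ZMod q)) (b0 k b : ZMod q) :
    vc A B b0 k 0 b = if b = b0 then 1 else 0 := by
  simp only [vc, rc]
  by_cases h : b = b0
  · simp [h]
  · simp [h]

theorem vc_succ {q : ℕ} [NeZero q] (A B : Finset (ZMod q)) (b0 k : ZMod q) (n : ℕ) (b : ZMod q) :
    vc A B b0 k (n + 1) b = ∑ a ∈ A, wc A B b0 k n a * ZMod.stdAddChar (N := q) (-k * b * a) := by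
  have h1 : vc A B b0 k (n + 1) b = ∑ b' ∈ B, ∑ a ∈ A,
      ∑ z, rc A B b0 n b' (z - a * (b' - b)) * ZMod.stdAddChar (N := q) (k * z) := by
    simp only [vc, rc, Finset.sum_mul]
    rw [Finset.sum_comm]
    refine Finset.sum_congr rfl fun b' _ => ?_
    rw [Finset.sum_comm]
  rw [h1, Finset.sum_comm]
  refine Finset.sum_congr rfl fun a _ => ?_
  rw [wc, Finset.sum_mul]
  refine Finset.sum_congr rfl fun b' _ => ?_
  rw [vc, Finset.sum_mul, Finset.sum_mul]
  rw [← Equiv.sum_comp (Equiv.addRight (a * (b' - b)))]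
  refine Finset.sum_congr rfl fun z _ => ?_
  simp only [Equiv.coe_addRight, add_sub_cancel_right]
  rw [mul_assoc, mul_assoc, ← AddChar.map_add_eq_mul, ← AddChar.map_add_eq_mul]
  congr 2
  ring

theorem wc_bound {q : ℕ} [NeZero q] (A B : Finset (ZMod q)) (k x y b0 : ZMod q) (hb0 : b0 ∈ B)
    (d e m : ℕ) (hm : addOrderOf (k * d * e) = m)
    (hA : ∀ a ∈ A, (d : ZMod q) ∣ a - x) (hB : ∀ b ∈ B, (e : ZMod q) ∣ b - y)
    (MA MB : ℝ)
    (hMA : ∀ z, ((A.filter (fun a => ((d * m : ℕ) : ZMod q) ∣ a - z)).card : ℝ) ≤ MA)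
    (hMB : ∀ z, ((B.filter (fun b => ((e * m : ℕ) : ZMod q) ∣ b - z)).card : ℝ) ≤ MB) (n : ℕ) :
    ∑ a ∈ A, ‖wc A B b0 k n a‖ ^ 2 ≤ (m * MA * MB) ^ (2 * n) * A.card := by
  have hMA0 : 0 ≤ MA := le_trans (by positivity) (hMA 0)
  have hMB0 : 0 ≤ MB := le_trans (by positivity) (hMB 0)
  induction n with
  | zero =>
    have : ∀ a ∈ A, ‖wc A B b0 k 0 a‖ ^ 2 = 1 := by
      intro a _
      simp [wc, vc_zero, hb0]
    rw [Finset.sum_congr rfl this]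
    simp
  | succ n ih =>
    have h1 := bilin k x y d e m hm A B hA hB MA MB hMA hMB (vc A B b0 k (n + 1))
    have hm' : addOrderOf (-k * e * d) = m := by
      rw [← hm, ← addOrderOf_neg]; congr 1; ring
    have h2 := bilin (-k) y x e d m hm' B A hB hA MB MA hMB hMA (wc A B b0 k n)
    have h3 : ∑ b ∈ B, ‖vc A B b0 k (n + 1) b‖ ^ 2 ≤ (m * MB * MA) * ((m * MA * MB) ^ (2 * n) * A.card) := by
      simp only [vc_succ]
      exact h2.trans (mul_le_mul_of_nonneg_left ih (by positivity))
    calc _ ≤ _ := h1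
      _ ≤ (m * MA * MB) * ((m * MB * MA) * ((m * MA * MB) ^ (2 * n) * A.card)) :=
        mul_le_mul_of_nonneg_left h3 (by positivity)
      _ = _ := by ring

theorem vc_bound {q : ℕ} [NeZero q] (A B : Finset (ZMod q)) (k x y b0 : ZMod q) (hb0 : b0 ∈ B)
    (d e m : ℕ) (hm : addOrderOf (k * d * e) = m)
    (hA : ∀ a ∈ A, (d : ZMod q) ∣ a - x) (hB : ∀ b ∈ B, (e : ZMod q) ∣ b - y)
    (s t : ℝ) (hst : s + t = 13 / 15)
    (hMA : ∀ z, ((A.filter (fun a => ((d * m : ℕ) : ZMod q) ∣ a - z)).card : ℝ)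
      ≤ A.card * (m : ℝ) ^ (s - 1))
    (hMB : ∀ z, ((B.filter (fun b => ((e * m : ℕ) : ZMod q) ∣ b - z)).card : ℝ)
      ≤ B.card * (m : ℝ) ^ (t - 1)) :
    ‖vc A B b0 k 24 b0‖ ≤ (A.card : ℝ) ^ 24 * (B.card : ℝ) ^ 23 * (1 / (m : ℝ) ^ 3) := by
  have hm0 : 0 < m := by rw [← hm]; exact addOrderOf_pos _
  have hm1 : (1 : ℝ) ≤ m := by exact_mod_cast hm0
  have hm0' : (0 : ℝ) < m := by positivity
  have h1 := wc_bound A B k x y b0 hb0 d e m hm hA hB _ _ hMA hMB 23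
  have hC : (m : ℝ) * (A.card * (m : ℝ) ^ (s - 1)) * (B.card * (m : ℝ) ^ (t - 1))
      = A.card * B.card * (m : ℝ) ^ (-(2 / 15) : ℝ) := by
    have : (m : ℝ) ^ (-(2 / 15) : ℝ) = m * (m : ℝ) ^ (s - 1) * (m : ℝ) ^ (t - 1) := by
      nth_rewrite 2 [← Real.rpow_one (m : ℝ)]
      rw [← Real.rpow_add hm0', ← Real.rpow_add hm0']
      congr 1; linarith
    rw [this]; ring
  rw [hC] at h1
  set C : ℝ := A.card * B.card * (m : ℝ) ^ (-(2 / 15) : ℝ) with hCdef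
  have hC0 : 0 ≤ C := by positivity
  have h2 : ‖vc A B b0 k 24 b0‖ ≤ ∑ a ∈ A, ‖wc A B b0 k 23 a‖ := by
    rw [vc_succ]
    refine (norm_sum_le _ _).trans (le_of_eq ?_)
    refine Finset.sum_congr rfl fun a _ => ?_
    rw [norm_mul, AddChar.norm_apply, mul_one]
  have h3 : (∑ a ∈ A, ‖wc A B b0 k 23 a‖) ^ 2 ≤ (C ^ 23 * A.card) ^ 2 := by
    refine (sq_sum_le_card_mul_sum_sq).trans ?_
    calc _ ≤ (A.card : ℝ) * (C ^ (2 * 23) * A.card) := by gcongr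
      _ = _ := by ring
  have h4 := abs_le_of_sq_le_sq h3 (by positivity)
  have h5 : C ^ 23 ≤ (A.card : ℝ) ^ 23 * (B.card : ℝ) ^ 23 * (1 / (m : ℝ) ^ 3) := by
    rw [hCdef, mul_pow, mul_pow]
    refine mul_le_mul_of_nonneg_left ?_ (by positivity)
    rw [← Real.rpow_natCast, ← Real.rpow_mul hm0'.le, one_div, ← Real.rpow_natCast,
      ← Real.rpow_neg hm0'.le]
    refine Real.rpow_le_rpow_of_exponent_le hm1 ?_
    norm_num
  calc _ ≤ _ := h2
    _ ≤ C ^ 23 * A.card := (le_abs_self _).trans h4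
    _ ≤ ((A.card : ℝ) ^ 23 * (B.card : ℝ) ^ 23 * (1 / (m : ℝ) ^ 3)) * A.card := by gcongr
    _ = _ := by ring

theorem vc_zero_freq {q : ℕ} [NeZero q] (A B : Finset (ZMod q)) (b0 : ZMod q) (hb0 : b0 ∈ B)
    (n : ℕ) (b : ZMod q) :
    vc A B b0 0 (n + 1) b = (A.card : ℂ) ^ (n + 1) * (B.card : ℂ) ^ n := by
  induction n generalizing b with
  | zero => simp [vc_succ, wc, vc_zero, hb0]
  | succ n ih =>
    rw [vc_succ]
    simp only [wc, ih, zero_mul, neg_zero, AddChar.map_zero_eq_one, mul_one, Finset.sum_const,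
      nsmul_eq_mul]
    ring

theorem inversion {q : ℕ} [NeZero q] (A B : Finset (ZMod q)) (b0 : ZMod q) (n : ℕ) (b z : ZMod q) :
    ∑ k, vc A B b0 k n b * ZMod.stdAddChar (N := q) (-(k * z)) = q * rc A B b0 n b z := by
  have h : ∀ k, vc A B b0 k n b * ZMod.stdAddChar (N := q) (-(k * z)) =
      ∑ w, rc A B b0 n b w * ZMod.stdAddChar (N := q) (k * (w - z)) := by
    intro k
    rw [vc, Finset.sum_mul]
    refine Finset.sum_congr rfl fun w _ => ?_
    rw [mul_assoc, ← AddChar.map_add_eq_mul]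
    congr 2; ring
  simp only [h]
  rw [Finset.sum_comm]
  simp only [← Finset.mul_sum]
  simp only [AddChar.sum_mulShift _ (ZMod.isPrimitive_stdAddChar q), sub_eq_zero, ZMod.card]
  simp
  ring

theorem sum_inv_sq (q : ℕ) (hq : 0 < q) :
    ∑ m ∈ Finset.Icc 2 q, (1 / ((m : ℕ) : ℝ) ^ 2) ≤ 1 - 1 / (q : ℝ) := by
  induction q, hq using Nat.le_induction with
  | base => simp
  | succ n hn ih =>
    rw [Finset.sum_Icc_succ_top (by omega)]
    have hn' : (0 : ℝ) < n := by exact_mod_cast hn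
    have : 1 / ((n + 1 : ℕ) : ℝ) ^ 2 ≤ 1 / n - 1 / ((n + 1 : ℕ) : ℝ) := by
      push_cast
      rw [div_sub_div _ _ hn'.ne' (by positivity), div_le_div_iff₀ (by positivity) (by positivity)]
      nlinarith
    linarith

theorem core {q : ℕ} [NeZero q] (A B A' B' : Finset (ZMod q)) (hAA : A ⊆ A') (hBB : B ⊆ B')
    (x y b0 : ZMod q) (hb0 : b0 ∈ B) (hAne : A.Nonempty) (d e : ℕ) (hd : d ∣ q) (he : e ∣ q)
    (hA : ∀ a ∈ A, (d : ZMod q) ∣ a - x) (hB : ∀ b ∈ B, (e : ZMod q) ∣ b - y)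
    (s t : ℝ) (hst : s + t = 13 / 15)
    (hMA : ∀ m : ℕ, d * m ∣ q → ∀ z, ((A.filter (fun a => ((d * m : ℕ) : ZMod q) ∣ a - z)).card : ℝ)
      ≤ A.card * (m : ℝ) ^ (s - 1))
    (hMB : ∀ m : ℕ, e * m ∣ q → ∀ z, ((B.filter (fun b => ((e * m : ℕ) : ZMod q) ∣ b - z)).card : ℝ)
      ≤ B.card * (m : ℝ) ^ (t - 1)) (x0 : ZMod q) :
    ((Nat.gcd (d * e) q : ℕ) : ZMod q) * x0 ∈ foldSum 24 (A' * B' - A' * B') := by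
  have hq : 0 < q := Nat.pos_of_ne_zero (NeZero.ne q)
  set g := Nat.gcd (d * e) q with hg
  have hg0 : 0 < g := Nat.gcd_pos_of_pos_right _ hq
  have hgq : g ∣ q := Nat.gcd_dvd_right _ _
  obtain ⟨v, hv⟩ : ∃ v : ZMod q, (g : ZMod q) = d * e * v := by
    refine ⟨((Nat.gcdA (d * e) q : ℤ) : ZMod q), ?_⟩
    have := congrArg (fun z : ℤ => (z : ZMod q)) (Nat.gcd_eq_gcd_ab (d * e) q)
    push_cast at this
    rw [hg, this]
    simp
  set z : ZMod q := g * x0 with hz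
  refine rc_mem A B A' B' hAA hBB b0 24 b0 hb0 z fun h0 => ?_
  have hinv := inversion A B b0 24 b0 z
  rw [h0, mul_zero] at hinv
  set W : ℝ := (A.card : ℝ) ^ 24 * (B.card : ℝ) ^ 23 with hW
  have hW0 : 0 < W := by
    have h1 : 0 < A.card := hAne.card_pos
    have h2 : 0 < B.card := Finset.card_pos.2 ⟨b0, hb0⟩
    positivity
  set Z : Finset (ZMod q) := Finset.univ.filter (fun k => k * d * e = 0) with hZ
  -- trivial frequencies
  have htriv : ∀ k ∈ Z, vc A B b0 k 24 b0 * ZMod.stdAddChar (N := q) (-(k * z)) = (W : ℂ) := by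
    intro k hk
    have hk0 : k * d * e = 0 := (Finset.mem_filter.1 hk).2
    have h1 : -(k * z) = 0 := by
      rw [hz, hv]; linear_combination (-v * x0) * hk0
    rw [h1, AddChar.map_zero_eq_one, mul_one]
    have h2 : vc A B b0 k 24 b0 = vc A B b0 0 24 b0 := by
      simp only [vc]
      refine Finset.sum_congr rfl fun w _ => ?_
      by_cases hr : rc A B b0 24 b0 w = 0
      · simp [hr]
      · obtain ⟨c, hc⟩ := rc_dvd A B x y d e hA hB b0 24 b0 hb0 w hr
        have : k * w = 0 * w := by
          linear_combination k * hc + c * hk0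
        rw [this]
    rw [h2, vc_zero_freq A B b0 hb0]
    rw [hW]; push_cast; ring
  have hord : ∀ k : ZMod q, d * addOrderOf (k * d * e) ∣ q ∧ e * addOrderOf (k * d * e) ∣ q := by
    intro k
    constructor
    · obtain ⟨c, hc⟩ := hd
      have : addOrderOf (k * d * e) ∣ c := by
        apply addOrderOf_dvd_of_nsmul_eq_zero
        have h := ZMod.natCast_self q
        rw [nsmul_eq_mul]
        have h' : (d : ZMod q) * c = 0 := by rw [← Nat.cast_mul, ← hc]; exact h
        linear_combination (k * e) * h'
      conv_rhs => rw [hc]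
      exact mul_dvd_mul_left _ this
    · obtain ⟨c, hc⟩ := he
      have : addOrderOf (k * d * e) ∣ c := by
        apply addOrderOf_dvd_of_nsmul_eq_zero
        have h := ZMod.natCast_self q
        rw [nsmul_eq_mul]
        have h' : (e : ZMod q) * c = 0 := by rw [← Nat.cast_mul, ← hc]; exact h
        linear_combination (k * d) * h'
      conv_rhs => rw [hc]
      exact mul_dvd_mul_left _ this
  have hbd : ∀ k, ‖vc A B b0 k 24 b0 * ZMod.stdAddChar (N := q) (-(k * z))‖
      ≤ W * (1 / (addOrderOf (k * d * e) : ℝ) ^ 3) := by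
    intro k
    rw [norm_mul, AddChar.norm_apply, mul_one]
    exact vc_bound A B k x y b0 hb0 d e _ rfl hA hB s t hst (hMA _ (hord k).1) (hMB _ (hord k).2)
  have hZcard : (g : ℝ) ≤ Z.card := by
    have : (Finset.range g).card ≤ Z.card := by
      obtain ⟨c, hc⟩ := hgq
      have hc0 : 0 < c := Nat.pos_of_ne_zero (by rintro rfl; omega)
      refine Finset.card_le_card_of_injOn (fun i => ((c * i : ℕ) : ZMod q)) ?_ ?_
      · intro i _
        simp only [hZ, Finset.coe_filter, Finset.mem_univ, true_and, Set.mem_setOf_eq]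
        obtain ⟨r, hr⟩ : g ∣ d * e := Nat.gcd_dvd_left _ _
        have h1 : c * i * d * e = q * (i * r) := by
          rw [mul_assoc, hr]; conv_rhs => rw [hc]
          ring
        rw [← Nat.cast_mul, ← Nat.cast_mul, h1]
        push_cast
        simp
      · intro i hi j hj hij
        simp only [Finset.coe_range, Set.mem_Iio] at hi hj
        have h1 := (ZMod.natCast_eq_natCast_iff' _ _ _).1 hij
        have hi' : c * i < q := by rw [hc, mul_comm g c]; exact Nat.mul_lt_mul_of_pos_left hi hc0
        have hj' : c * j < q := by rw [hc, mul_comm g c]; exact Nat.mul_lt_mul_of_pos_left hj hc0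
        rw [Nat.mod_eq_of_lt hi', Nat.mod_eq_of_lt hj'] at h1
        exact Nat.eq_of_mul_eq_mul_left hc0 h1
    rw [Finset.card_range] at this
    exact_mod_cast this
  have hcount : ∀ m : ℕ, 0 < m →
      (((Finset.univ.filter (fun k : ZMod q => addOrderOf (k * d * e) = m)).card : ℕ) : ℝ) ≤ g * m := by
    intro m hm
    have h1 := IsAddCyclic.card_nsmul_eq_zero_le (α := ZMod q) (n := g * m) (by positivity)
    have h2 : (Finset.univ.filter (fun k : ZMod q => addOrderOf (k * d * e) = m)).card ≤ g * m := by
      refine le_trans (Finset.card_le_card ?_) h1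
      intro k hk
      simp only [Finset.mem_filter, Finset.mem_univ, true_and] at hk ⊢
      have h3 := addOrderOf_nsmul_eq_zero (k * d * e)
      rw [hk, nsmul_eq_mul] at h3
      rw [nsmul_eq_mul, Nat.cast_mul, hv]
      linear_combination v * h3
    exact_mod_cast h2
  have hsum : ∑ k ∈ Finset.univ.filter (fun k : ZMod q => ¬ k * d * e = 0),
      (1 / (addOrderOf (k * d * e) : ℝ) ^ 3) ≤ g * (1 - 1 / (q : ℝ)) := by
    have hmap : ∀ k ∈ Finset.univ.filter (fun k : ZMod q => ¬ k * d * e = 0),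
        addOrderOf (k * d * e) ∈ Finset.Icc 2 q := by
      intro k hk
      simp only [Finset.mem_filter, Finset.mem_univ, true_and] at hk
      have h1 : 0 < addOrderOf (k * d * e) := addOrderOf_pos _
      have h2 : addOrderOf (k * d * e) ≠ 1 := fun h => hk (AddMonoid.addOrderOf_eq_one_iff.1 h)
      have h3 : addOrderOf (k * d * e) ≤ q :=
        Nat.le_of_dvd hq (dvd_trans (dvd_mul_left _ _) (hord k).1)
      rw [Finset.mem_Icc]; omega
    rw [← Finset.sum_fiberwise_of_maps_to hmap]
    refine le_trans ?_ (mul_le_mul_of_nonneg_left (sum_inv_sq q hq) (Nat.cast_nonneg g))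
    rw [Finset.mul_sum]
    refine Finset.sum_le_sum fun m hm => ?_
    have hm2 : 2 ≤ m := (Finset.mem_Icc.1 hm).1
    have hm0 : 0 < m := by omega
    have hmR : (0 : ℝ) < m := by exact_mod_cast hm0
    have hc : ∀ k ∈ (Finset.univ.filter (fun k : ZMod q => ¬ k * d * e = 0)).filter
        (fun k : ZMod q => addOrderOf (k * d * e) = m),
        (1 / (addOrderOf (k * d * e) : ℝ) ^ 3) = 1 / (m : ℝ) ^ 3 := by
      intro k hk
      rw [(Finset.mem_filter.1 hk).2]
    rw [Finset.sum_congr rfl hc, Finset.sum_const, nsmul_eq_mul]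
    have hle : ((((Finset.univ.filter (fun k : ZMod q => ¬ k * d * e = 0)).filter
        (fun k : ZMod q => addOrderOf (k * d * e) = m)).card : ℕ) : ℝ) ≤ g * m := by
      refine le_trans ?_ (hcount m hm0)
      have : ((Finset.univ.filter (fun k : ZMod q => ¬ k * d * e = 0)).filter
        (fun k : ZMod q => addOrderOf (k * d * e) = m)).card ≤
        (Finset.univ.filter (fun k : ZMod q => addOrderOf (k * d * e) = m)).card := by
        refine Finset.card_le_card ?_
        intro k hk
        simp only [Finset.mem_filter, Finset.mem_univ, true_and] at hk ⊢
        exact hk.2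
      exact_mod_cast this
    calc _ ≤ (g * m : ℝ) * (1 / (m : ℝ) ^ 3) := by gcongr
      _ = _ := by field_simp
  rw [← Finset.sum_filter_add_sum_filter_not Finset.univ (fun k : ZMod q => k * d * e = 0),
    Finset.sum_congr rfl htriv, Finset.sum_const, nsmul_eq_mul] at hinv
  have heq := eq_neg_of_add_eq_zero_left hinv
  have hnorm : (Z.card : ℝ) * W ≤ W * (g * (1 - 1 / (q : ℝ))) := by
    have h1 : (Z.card : ℝ) * W = ‖(Z.card : ℂ) * (W : ℂ)‖ := by
      rw [norm_mul, Complex.norm_natCast, Complex.norm_real, Real.norm_of_nonneg hW0.le]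
    rw [h1, heq, norm_neg]
    refine (norm_sum_le _ _).trans ?_
    refine (Finset.sum_le_sum fun k _ => hbd k).trans ?_
    rw [← Finset.mul_sum]
    exact mul_le_mul_of_nonneg_left hsum hW0.le
  have hqR : (0 : ℝ) < 1 / (q : ℝ) := by positivity
  have hgR : (0 : ℝ) < g := by exact_mod_cast hg0
  have h5 : (g : ℝ) * W ≤ W * (g * (1 - 1 / (q : ℝ))) :=
    (mul_le_mul_of_nonneg_right hZcard hW0.le).trans hnorm
  have : 0 < W * g * (1 / (q : ℝ)) := by positivity
  nlinarith

theorem coset_card {q : ℕ} [NeZero q] (A : Finset (ZMod q)) (d : ℕ) (hd : d ∣ q) (x : ZMod q) :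
    (A.filter (fun a => (d : ZMod q) ∣ a - x)).card * d ≤ q := by
  have h := Finset.card_le_card_of_injOn (s := (A.filter (fun a => (d : ZMod q) ∣ a - x)) ×ˢ
    Finset.range d) (t := (Finset.univ : Finset (ZMod q))) (fun p => p.1 + (p.2 : ℕ))
    (fun _ _ => Finset.mem_coe.2 (Finset.mem_univ _)) ?_
  · simpa [ZMod.card] using h
  · rintro ⟨a, i⟩ h1 ⟨a', i'⟩ h2 h3
    simp only [Finset.coe_product, Set.mem_prod, Finset.mem_coe, Finset.mem_filter,
      Finset.mem_range] at h1 h2 h3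
    have h4 : (d : ZMod q) ∣ (i : ZMod q) - i' := by
      have : (i : ZMod q) - i' = (a' - x) - (a - x) := by linear_combination h3
      rw [this]; exact dvd_sub h2.1.2 h1.1.2
    have h5 : i = i' := by
      have h6 := map_dvd (ZMod.castHom hd (ZMod d)) h4
      simp only [map_natCast, map_sub, ZMod.natCast_self, zero_dvd_iff, sub_eq_zero] at h6
      have h7 := (ZMod.natCast_eq_natCast_iff' _ _ _).1 h6
      rwa [Nat.mod_eq_of_lt h1.2, Nat.mod_eq_of_lt h2.2] at h7
    subst h5
    simpa using h3

theorem select {q : ℕ} [NeZero q] (A : Finset (ZMod q)) (hA : A.Nonempty) :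
    ∃ (D : ℕ → ℕ) (X : ℕ → ZMod q), (∀ k, D k ∣ q) ∧
      (∀ k, (A.filter (fun a => (D k : ZMod q) ∣ a - X k)).Nonempty) ∧
      (∀ k m : ℕ, D k * m ∣ q → ∀ z,
        ((A.filter (fun a => ((D k * m : ℕ) : ZMod q) ∣ a - z)).card : ℝ) ≤
          ((A.filter (fun a => (D k : ZMod q) ∣ a - X k)).card : ℝ) * (m : ℝ) ^ ((k : ℝ) / 30 - 1)) ∧
      ∑ k ∈ Finset.range 25, Real.log (D (k + 1)) ≤ 30 * (Real.log q - Real.log A.card) := by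
  have hq : 0 < q := Nat.pos_of_ne_zero (NeZero.ne q)
  have hX : ∀ d : ℕ, ∃ x : ZMod q, ∀ z, (A.filter (fun a => (d : ZMod q) ∣ a - z)).card ≤
      (A.filter (fun a => (d : ZMod q) ∣ a - x)).card := by
    intro d
    obtain ⟨x, _, hx⟩ := Finset.exists_max_image (Finset.univ : Finset (ZMod q))
      (fun z => (A.filter (fun a => (d : ZMod q) ∣ a - z)).card) Finset.univ_nonempty
    exact ⟨x, fun z => hx z (Finset.mem_univ _)⟩
  choose X hX using hX
  set M : ℕ → ℕ := fun d => (A.filter (fun a => (d : ZMod q) ∣ a - X d)).card with hM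
  have hMpos : ∀ d, 0 < M d := by
    intro d
    obtain ⟨a, ha⟩ := hA
    refine lt_of_lt_of_le (Finset.card_pos.2 ⟨a, ?_⟩) (hX d a)
    simp [ha]
  set G : ℕ → ℝ := fun d => Real.log (M d) + Real.log d with hG
  have hD : ∀ k : ℕ, ∃ d ∈ q.divisors, ∀ d' ∈ q.divisors,
      G d' - k / 30 * Real.log d' ≤ G d - k / 30 * Real.log d := fun k =>
    Finset.exists_max_image _ _ ⟨1, by simp [hq.ne']⟩
  choose D hDq hDmax using hD
  have hDdvd : ∀ k, D k ∣ q := fun k => Nat.dvd_of_mem_divisors (hDq k)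
  have hDpos : ∀ k, 0 < D k := fun k => Nat.pos_of_dvd_of_pos (hDdvd k) hq
  refine ⟨D, fun k => X (D k), hDdvd, fun k => Finset.card_pos.1 (hMpos _), ?_, ?_⟩
  · intro k m hm z
    have hm0 : 0 < m := Nat.pos_of_ne_zero (by rintro rfl; simp at hm; omega)
    have hmR : (0 : ℝ) < m := by exact_mod_cast hm0
    have hDR : (0 : ℝ) < D k := by exact_mod_cast hDpos k
    have h1 := hDmax k (D k * m) (Nat.mem_divisors.2 ⟨hm, hq.ne'⟩)
    have hMR : ∀ d, (0 : ℝ) < M d := fun d => by exact_mod_cast hMpos d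
    have h2 : (M (D k * m) : ℝ) ≤ M (D k) * (m : ℝ) ^ ((k : ℝ) / 30 - 1) := by
      rw [← Real.log_le_log_iff (hMR _) (mul_pos (hMR _) (Real.rpow_pos_of_pos hmR _)),
        Real.log_mul (hMR _).ne' (Real.rpow_pos_of_pos hmR _).ne', Real.log_rpow hmR]
      simp only [hG] at h1
      push_cast at h1
      rw [Real.log_mul hDR.ne' hmR.ne'] at h1
      linarith
    refine le_trans ?_ h2
    exact_mod_cast hX (D k * m) z
  · have hstep : ∀ k : ℕ, (G (D (k + 1)) - ((k + 1 : ℕ) : ℝ) / 30 * Real.log (D (k + 1)))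
        + 1 / 30 * Real.log (D (k + 1)) ≤ G (D k) - k / 30 * Real.log (D k) := by
      intro k
      have := hDmax k (D (k + 1)) (hDq _)
      push_cast
      linarith
    have hind : ∀ n : ℕ, (G (D n) - n / 30 * Real.log (D n)) +
        1 / 30 * ∑ k ∈ Finset.range n, Real.log (D (k + 1)) ≤ G (D 0) := by
      intro n
      induction n with
      | zero => simp
      | succ n ih =>
        rw [Finset.sum_range_succ]
        have := hstep n
        linarith
    have h0 : G (D 0) ≤ Real.log q := by
      simp only [hG]
      have h1 : (0 : ℝ) < M (D 0) := by exact_mod_cast hMpos _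
      have h2 : (0 : ℝ) < D 0 := by exact_mod_cast hDpos _
      rw [← Real.log_mul h1.ne' h2.ne']
      refine Real.log_le_log (by positivity) ?_
      exact_mod_cast coset_card A (D 0) (hDdvd 0) _
    have h25 := hDmax 25 1 (by simp [hq.ne'])
    have hM1 : M 1 = A.card := by simp [hM]
    have hG1 : G 1 = Real.log A.card := by simp [hG, hM1]
    have := hind 25
    rw [hG1] at h25
    simp only [Nat.cast_one, Real.log_one, mul_zero, sub_zero] at h25
    linarith

theorem stmt10 (q : ℕ) (hq : 0 < q) (γ : ℝ) (hγ0 : 0 < γ) (hγ1 : γ < 1 / 4)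
    (A B : Finset (ZMod q))
    (hA : ((A.card : ℝ) > (q : ℝ) ^ ((1 : ℝ) - γ)))
    (hB : ((B.card : ℝ) > (q : ℝ) ^ ((1 : ℝ) - γ))) :
    ∃ q' : ℕ, q' ∣ q ∧ ((q' : ℝ) < (q : ℝ) ^ (12 * γ / 5)) ∧
      ∀ x : ZMod q, (q' : ZMod q) * x ∈ foldSum 24 (A * B - A * B) := by
  haveI : NeZero q := ⟨hq.ne'⟩
  have hqR : (0 : ℝ) < q := by exact_mod_cast hq
  have key : ∀ S : Finset (ZMod q), ((S.card : ℝ) > (q : ℝ) ^ ((1 : ℝ) - γ)) →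
      S.Nonempty ∧ Real.log q - Real.log S.card < γ * Real.log q := by
    intro S hS
    have hpos := Real.rpow_pos_of_pos hqR (1 - γ)
    refine ⟨Finset.card_pos.1 (by exact_mod_cast hpos.trans hS), ?_⟩
    have := Real.log_lt_log hpos hS
    rw [Real.log_rpow hqR] at this
    linarith
  obtain ⟨hAne, hAlog⟩ := key A hA
  obtain ⟨hBne, hBlog⟩ := key B hB
  obtain ⟨D, X, hDq, hDne, hDM, hDs⟩ := select A hAne
  obtain ⟨E, Y, hEq, hEne, hEM, hEs⟩ := select B hBne
  obtain ⟨i, hi, hlt⟩ : ∃ i ∈ Finset.range 25,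
      Real.log (D (i + 1)) + Real.log (E (25 - 1 - i + 1)) < 12 * γ / 5 * Real.log q := by
    by_contra! hcon
    have h1 := Finset.sum_le_sum hcon
    rw [Finset.sum_add_distrib, Finset.sum_range_reflect (fun j => Real.log (E (j + 1))) 25,
      Finset.sum_const, Finset.card_range, nsmul_eq_mul] at h1
    push_cast at h1
    linarith
  set d := D (i + 1) with hd
  set e := E (25 - 1 - i + 1) with he
  have hd0 : (0 : ℝ) < d := by exact_mod_cast Nat.pos_of_dvd_of_pos (hDq _) hq
  have he0 : (0 : ℝ) < e := by exact_mod_cast Nat.pos_of_dvd_of_pos (hEq _) hq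
  refine ⟨Nat.gcd (d * e) q, Nat.gcd_dvd_right _ _, ?_, ?_⟩
  · have h1 : ((Nat.gcd (d * e) q : ℕ) : ℝ) ≤ d * e := by
      have : 0 < d * e := by
        have : (0 : ℝ) < d * e := by positivity
        exact_mod_cast this
      exact_mod_cast Nat.gcd_le_left q this
    refine lt_of_le_of_lt h1 ?_
    rw [← Real.log_lt_log_iff (by positivity) (Real.rpow_pos_of_pos hqR _),
      Real.log_mul hd0.ne' he0.ne', Real.log_rpow hqR]
    exact hlt
  · obtain ⟨b0, hb0⟩ := hEne (25 - 1 - i + 1)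
    refine core _ _ A B (Finset.filter_subset _ _) (Finset.filter_subset _ _) (X (i + 1))
      (Y (25 - 1 - i + 1)) b0 hb0 (hDne (i + 1)) d e (hDq _) (hEq _)
      (fun a ha => (Finset.mem_filter.1 ha).2) (fun b hb => (Finset.mem_filter.1 hb).2)
      (((i + 1 : ℕ) : ℝ) / 30) (((25 - 1 - i + 1 : ℕ) : ℝ) / 30) ?_ ?_ ?_
    · have hi' := Finset.mem_range.1 hi
      have : (i + 1) + (25 - 1 - i + 1) = 26 := by omega
      have h2 : ((i + 1 : ℕ) : ℝ) + ((25 - 1 - i + 1 : ℕ) : ℝ) = 26 := by exact_mod_cast this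
      linarith
    · intro m hm z
      refine le_trans ?_ (hDM (i + 1) m hm z)
      exact_mod_cast Finset.card_le_card (Finset.filter_subset_filter _ (Finset.filter_subset _ _))
    · intro m hm z
      refine le_trans ?_ (hEM (25 - 1 - i + 1) m hm z)
      exact_mod_cast Finset.card_le_card (Finset.filter_subset_filter _ (Finset.filter_subset _ _))
end
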